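/- Assume MSCD. Let t₁,…,t_m ∈ ℍ be a convenient tuple for j. Then for all z₁,…,zₙ ∈ ℍ: tr.deg_ℚ ℚ(z, t, J(z), J(t)) ≥ 3·dim_G(z, t|Σ) + dim^j(t), and tr.deg_ℚ ℚ(z, t, j(z), j(t)) ≥ dim_G(z, t|Σ) + dim^j(t). -/

import Mathlib

noncomputable section

namespace ModularJPaper

/-! ### Basic objects: the upper half-plane, Möbius actions, the modular `j`-function -/

/-- The complex upper half-plane, as a subset of `ℂ`. -/
def HH : Set ℂ := {z : ℂ | 0 < z.im}

/-- The Möbius action of a complex 2×2 matrix on `ℂ`. -/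
def moeb (g : Matrix (Fin 2) (Fin 2) ℂ) (z : ℂ) : ℂ :=
  (g 0 0 * z + g 0 1) / (g 1 0 * z + g 1 1)

/-- A rational 2×2 matrix viewed as a complex one. -/
def qmat (g : Matrix (Fin 2) (Fin 2) ℚ) : Matrix (Fin 2) (Fin 2) ℂ :=
  g.map (fun a => (a : ℂ))

/-- An integer 2×2 matrix viewed as a complex one. -/
def zmat (g : Matrix (Fin 2) (Fin 2) ℤ) : Matrix (Fin 2) (Fin 2) ℂ :=
  g.map (fun a => (a : ℂ))

/-- `IsModularJ j` says that `j : ℂ → ℂ` restricts on the upper half-plane to *the*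
modular `j`-function: it is holomorphic on `ℍ`, invariant under `SL₂(ℤ)`, and has a
Fourier expansion `j(z) = q⁻¹ + 744 + ∑_{k ≥ 1} a_k q^k` with `q = exp(2πiz)`.
(These properties determine `j` uniquely on `ℍ`.) -/
structure IsModularJ (j : ℂ → ℂ) : Prop where
  holo : DifferentiableOn ℂ j HH
  invariant : ∀ g : Matrix (Fin 2) (Fin 2) ℤ, g.det = 1 → ∀ z ∈ HH, j (moeb (zmat g) z) = j z
  fourier : ∃ a : ℕ → ℂ, ∀ z ∈ HH,
    HasSum (fun k : ℕ => a k * Complex.exp (2 * (Real.pi : ℂ) * Complex.I * z) ^ (k + 1))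
      (j z - (Complex.exp (2 * (Real.pi : ℂ) * Complex.I * z))⁻¹ - 744)

/-! ### Algebraic sets, Zariski closure, irreducibility, dimension -/

/-- `V` is an algebraic subset of `ℂ^ι` (the common zero set of a family of polynomials). -/
def IsAlgSet {ι : Type*} (V : Set (ι → ℂ)) : Prop :=
  ∃ P : Set (MvPolynomial ι ℂ), V = {x | ∀ p ∈ P, MvPolynomial.eval x p = 0}

/-- `V` is an algebraic subset of `ℂ^ι` defined by polynomials with coefficients in `L`. -/
def IsAlgSetOver {ι : Type*} (L : Set ℂ) (V : Set (ι → ℂ)) : Prop :=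
  ∃ P : Set (MvPolynomial ι ℂ),
    (∀ p ∈ P, ∀ m : ι →₀ ℕ, MvPolynomial.coeff m p ∈ L) ∧
    V = {x | ∀ p ∈ P, MvPolynomial.eval x p = 0}

/-- The Zariski closure of a subset of `ℂ^ι`. -/
def zcl {ι : Type*} (S : Set (ι → ℂ)) : Set (ι → ℂ) :=
  ⋂₀ {T | IsAlgSet T ∧ S ⊆ T}

/-- Irreducibility (in the Zariski topology) of a subset of `ℂ^ι`. -/
def IsIrr {ι : Type*} (S : Set (ι → ℂ)) : Prop :=
  S.Nonempty ∧ ∀ V W : Set (ι → ℂ), IsAlgSet V → IsAlgSet W → S ⊆ V ∪ W → S ⊆ V ∨ S ⊆ W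

/-- The dimension of (the Zariski closure of) a subset of `ℂ^ι`: the supremum of the
lengths of strictly increasing chains of irreducible algebraic subsets of its closure. -/
def adim {ι : Type*} (S : Set (ι → ℂ)) : ℕ :=
  sSup {k : ℕ | ∃ c : Fin (k + 1) → Set (ι → ℂ), StrictMono c ∧
    ∀ i, IsAlgSet (c i) ∧ IsIrr (c i) ∧ c i ⊆ zcl S}

/-- `X` is an irreducible component of (the Zariski closure of) the set `A`. -/
def IsIrrCompOf {ι : Type*} (X A : Set (ι → ℂ)) : Prop :=
  IsAlgSet X ∧ IsIrr X ∧ X ⊆ zcl A ∧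
    ∀ Y : Set (ι → ℂ), IsAlgSet Y → IsIrr Y → Y ⊆ zcl A → X ⊆ Y → X = Y

/-- Constructible subsets of `ℂ^ι`: finite unions of differences of algebraic sets. -/
def IsConstr {ι : Type*} (S : Set (ι → ℂ)) : Prop :=
  ∃ (k : ℕ) (A B : Fin k → Set (ι → ℂ)),
    (∀ i, IsAlgSet (A i) ∧ IsAlgSet (B i)) ∧ S = ⋃ i, A i \ B i

/-- No coordinate is constant on `V`. -/
def NoConstCoord {ι : Type*} (V : Set (ι → ℂ)) : Prop :=
  ∀ (i : ι) (c : ℂ), ∃ v ∈ V, v i ≠ c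

/-- The fibre of a parametric family `F ⊆ ℂ^ι × ℂ^κ` over the parameter `q`. -/
def fib {ι κ : Type*} (F : Set ((ι ⊕ κ) → ℂ)) (q : κ → ℂ) : Set (ι → ℂ) :=
  {s | Sum.elim s q ∈ F}

/-! ### Transcendence degree and finitely generated subfields of `ℂ` -/

/-- The transcendence degree `tr.deg_K K(v)` of the field generated over `K` by the
coordinates of the tuple `v`: the maximal size of a subfamily of `v` that is
algebraically independent over `K`. -/
def trdegF (K : Subfield ℂ) {ι : Type*} (v : ι → ℂ) : ℕ :=
  sSup {k : ℕ | ∃ t : Finset ι, t.card = k ∧ AlgebraicIndependent K (fun i : t => v i.1)}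

/-- `K` is a finitely generated subfield of `ℂ`. -/
def FGField (K : Subfield ℂ) : Prop :=
  ∃ s : Finset ℂ, K = Subfield.closure ↑s

/-! ### The set Σ of quadratic points, `GL₂⁺(ℚ)`-orbits, special points -/

/-- `Σ`: the quadratic points of the upper half-plane. -/
def SigmaSet : Set ℂ := {z | z ∈ HH ∧ (minpoly ℚ z).natDegree = 2}

/-- `x` and `y` are related by the Möbius action of an element of `G = GL₂⁺(ℚ)`. -/
def GRel (x y : ℂ) : Prop :=
  ∃ g : Matrix (Fin 2) (Fin 2) ℚ, 0 < g.det ∧ moeb (qmat g) x = y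

/-- The `GL₂⁺(ℚ)`-orbit of `x`. -/
def Gorb (x : ℂ) : Set ℂ := {y | GRel x y}

/-- `dim_G(z | C)`: the number of distinct `G`-orbits of coordinates of the tuple `z`
which contain no element of `C`. -/
def dimG {ι : Type*} (z : ι → ℂ) (C : Set ℂ) : ℕ :=
  Set.ncard {S : Set ℂ | ∃ i : ι, S = Gorb (z i) ∧ ∀ c ∈ C, ¬ GRel (z i) c}

/-- `w` is a special point (singular modulus): `w = j(τ)` for a quadratic `τ ∈ ℍ`. -/
def IsSpecialPt (j : ℂ → ℂ) (w : ℂ) : Prop := ∃ τ ∈ SigmaSet, w = j τ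

/-- The zero set of the modular polynomial `Φ_N`, described via the modular
correspondence: `Φ_N(x,y) = 0` iff `x = j(z)` and `y = j(gz)` for some `z ∈ ℍ` and
some primitive integer matrix `g` of determinant `N`. -/
def PhiRel (j : ℂ → ℂ) (N : ℕ) (x y : ℂ) : Prop :=
  ∃ z ∈ HH, ∃ g : Matrix (Fin 2) (Fin 2) ℤ, g.det = (N : ℤ) ∧
    Nat.gcd (Int.gcd (g 0 0) (g 0 1)) (Int.gcd (g 1 0) (g 1 1)) = 1 ∧
    x = j z ∧ y = j (moeb (zmat g) z)

/-! ### Special, weakly special and Möbius subvarieties -/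

/-- An algebraic set cut out by modular relations `Φ_N(Y_i, Y_k) = 0` and by equations
`Y_i = τ` with `τ` a special point. -/
def IsSpecialBase {ι : Type*} (j : ℂ → ℂ) (B : Set (ι → ℂ)) : Prop :=
  ∃ (R : Set (ι × ι × ℕ)) (E : Set (ι × ℂ)),
    (∀ r ∈ R, 1 ≤ r.2.2) ∧ (∀ e ∈ E, IsSpecialPt j e.2) ∧
    B = {y | (∀ r ∈ R, PhiRel j r.2.2 (y r.1) (y r.2.1)) ∧ ∀ e ∈ E, y e.1 = e.2}

/-- A special subvariety of `Y(1)^ι`: an irreducible component of an algebraic set cut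
out by modular relations and special-point constant equations. -/
def IsSpecial {ι : Type*} (j : ℂ → ℂ) (T : Set (ι → ℂ)) : Prop :=
  ∃ B, IsSpecialBase j B ∧ IsIrrCompOf T B

/-- A weakly special subvariety of `Y(1)^ι`: an irreducible component of an algebraic
set cut out by modular relations and arbitrary constant equations. -/
def IsWSpecial {ι : Type*} (j : ℂ → ℂ) (T : Set (ι → ℂ)) : Prop :=
  ∃ (R : Set (ι × ι × ℕ)) (E : Set (ι × ℂ)), (∀ r ∈ R, 1 ≤ r.2.2) ∧
    IsIrrCompOf T {y | (∀ r ∈ R, PhiRel j r.2.2 (y r.1) (y r.2.1)) ∧ ∀ e ∈ E, y e.1 = e.2}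

/-- A weakly special subvariety of complexity at most `N`: only modular polynomials
`Φ_M` with `M ≤ N` are needed to define it. -/
def IsWSpecialLE {ι : Type*} (j : ℂ → ℂ) (N : ℕ) (T : Set (ι → ℂ)) : Prop :=
  ∃ (R : Set (ι × ι × ℕ)) (E : Set (ι × ℂ)), (∀ r ∈ R, 1 ≤ r.2.2 ∧ r.2.2 ≤ N) ∧
    IsIrrCompOf T {y | (∀ r ∈ R, PhiRel j r.2.2 (y r.1) (y r.2.1)) ∧ ∀ e ∈ E, y e.1 = e.2}

/-- A basic special subvariety: a special subvariety with no constant coordinates. -/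
def IsBasicSpecial {ι : Type*} (j : ℂ → ℂ) (T : Set (ι → ℂ)) : Prop :=
  IsSpecial j T ∧ NoConstCoord T

/-- The special closure of `X`: the smallest special subvariety containing `X`. -/
def spcl {ι : Type*} (j : ℂ → ℂ) (X : Set (ι → ℂ)) : Set (ι → ℂ) :=
  ⋂₀ {T | IsSpecial j T ∧ X ⊆ T}

/-- The weakly special closure of `X`. -/
def wspcl {ι : Type*} (j : ℂ → ℂ) (X : Set (ι → ℂ)) : Set (ι → ℂ) :=
  ⋂₀ {T | IsWSpecial j T ∧ X ⊆ T}

/-- The Möbius relation `M_g(x,y) = y(cx+d) - (ax+b) = 0` attached to a 2×2 matrix. -/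
def MrelC (g : Matrix (Fin 2) (Fin 2) ℂ) (x y : ℂ) : Prop :=
  y * (g 1 0 * x + g 1 1) - (g 0 0 * x + g 0 1) = 0

/-- A 2×2 matrix is non-scalar. -/
def NonScalar (g : Matrix (Fin 2) (Fin 2) ℂ) : Prop :=
  ¬ (g 0 1 = 0 ∧ g 1 0 = 0 ∧ g 0 0 = g 1 1)

/-- A Möbius subvariety of `ℂ^ι`: cut out by finitely many relations `M_g(X_i, X_k) = 0`
with `g` non-scalar in `GL₂(ℂ)`. -/
def IsMoebius {ι : Type*} (M : Set (ι → ℂ)) : Prop :=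
  ∃ (D : Finset (ι × ι)) (f : ι × ι → Matrix (Fin 2) (Fin 2) ℂ),
    (∀ p ∈ D, (f p).det ≠ 0 ∧ NonScalar (f p)) ∧
    M = {x | ∀ p ∈ D, MrelC (f p) (x p.1) (x p.2)}

/-- A Möbius subvariety of `ℂ^ι` defined by matrices in `G = GL₂⁺(ℚ)`. -/
def IsMoebiusQpos {ι : Type*} (M : Set (ι → ℂ)) : Prop :=
  ∃ (D : Finset (ι × ι)) (f : ι × ι → Matrix (Fin 2) (Fin 2) ℚ),
    (∀ p ∈ D, 0 < (f p).det ∧ NonScalar (qmat (f p))) ∧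
    M = {x | ∀ p ∈ D, MrelC (qmat (f p)) (x p.1) (x p.2)}

/-- A Möbius subvariety of `ℂ^ι` defined over `ℚ` (rational invertible non-scalar
matrices). -/
def IsMoebiusRat {ι : Type*} (M : Set (ι → ℂ)) : Prop :=
  ∃ (D : Finset (ι × ι)) (f : ι × ι → Matrix (Fin 2) (Fin 2) ℚ),
    (∀ p ∈ D, (f p).det ≠ 0 ∧ NonScalar (qmat (f p))) ∧
    M = {x | ∀ p ∈ D, MrelC (qmat (f p)) (x p.1) (x p.2)}

/-! ### The two-sorted space `ℂⁿ × Y(1)ⁿ`, broadness, freeness, (EC) -/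

/-- The coordinate projection `Pr_i : ℂⁿ × Y(1)ⁿ → ℂ^ℓ × Y(1)^ℓ` attached to a tuple
`i₁ < ⋯ < i_ℓ`. -/
def prSum {n ℓ : ℕ} (i : Fin ℓ → Fin n) (v : (Fin n ⊕ Fin n) → ℂ) : (Fin ℓ ⊕ Fin ℓ) → ℂ :=
  Sum.elim (fun k => v (Sum.inl (i k))) (fun k => v (Sum.inr (i k)))

/-- `V ⊆ ℂⁿ × Y(1)ⁿ` is broad: `dim Pr_i(V) ≥ ℓ` for every tuple `i₁ < ⋯ < i_ℓ`. -/
def Broad {n : ℕ} (V : Set ((Fin n ⊕ Fin n) → ℂ)) : Prop :=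
  ∀ (ℓ : ℕ) (i : Fin ℓ → Fin n), 1 ≤ ℓ → StrictMono i → ℓ ≤ adim (prSum i '' V)

/-- `V ⊆ ℂⁿ × Y(1)ⁿ` is modularly free: `V` is not contained in `ℂⁿ × T` for any proper
special subvariety `T` of `Y(1)ⁿ`. -/
def ModularlyFree {n : ℕ} (j : ℂ → ℂ) (V : Set ((Fin n ⊕ Fin n) → ℂ)) : Prop :=
  ∀ T : Set (Fin n → ℂ), IsSpecial j T → T ≠ Set.univ →
    ¬ V ⊆ {v | (fun k => v (Sum.inr k)) ∈ T}

/-- `V ⊆ ℂⁿ × Y(1)ⁿ` is free. -/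
def Free {n : ℕ} (j : ℂ → ℂ) (V : Set ((Fin n ⊕ Fin n) → ℂ)) : Prop :=
  NoConstCoord V ∧
  (∀ M : Set (Fin n → ℂ), IsMoebiusQpos M → M ≠ Set.univ →
    ¬ V ⊆ {v | (fun k => v (Sum.inl k)) ∈ M}) ∧
  ModularlyFree j V

/-- The graph `E_jⁿ ⊆ ℂⁿ × Y(1)ⁿ` of the `j`-function. -/
def Ej (j : ℂ → ℂ) (n : ℕ) : Set ((Fin n ⊕ Fin n) → ℂ) :=
  {v | (∀ k, v (Sum.inl k) ∈ HH) ∧ ∀ k, v (Sum.inr k) = j (v (Sum.inl k))}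

/-- `V` satisfies (EC): `V ∩ E_jⁿ` is Zariski dense in `V`. -/
def SatisfiesEC {n : ℕ} (j : ℂ → ℂ) (V : Set ((Fin n ⊕ Fin n) → ℂ)) : Prop :=
  V ⊆ zcl (V ∩ Ej j n)

/-! ### MSCD and MZP -/

/-- The modular Schanuel conjecture with derivatives. -/
def MSCD (j : ℂ → ℂ) : Prop :=
  ∀ (n : ℕ) (z : Fin n → ℂ), (∀ i, z i ∈ HH) →
    3 * dimG z SigmaSet ≤
      trdegF ⊥ (fun p : Fin 4 × Fin n =>
        ![z, j ∘ z, deriv j ∘ z, deriv (deriv j) ∘ z] p.1 p.2)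

/-- `X` is an atypical component of `W ⊆ Y(1)ⁿ`: an irreducible component of `W ∩ T`,
for some special subvariety `T`, with `dim X > dim W + dim T − n`. -/
def IsAtypComp {n : ℕ} (j : ℂ → ℂ) (W X : Set (Fin n → ℂ)) : Prop :=
  ∃ T, IsSpecial j T ∧ IsIrrCompOf X (W ∩ T) ∧
    (adim W : ℤ) + (adim T : ℤ) - (n : ℤ) < (adim X : ℤ)

/-- The modular Zilber–Pink conjecture: every subvariety of `Y(1)ⁿ` has finitely many
maximal atypical components. -/
def MZP (j : ℂ → ℂ) : Prop :=
  ∀ (n : ℕ) (W : Set (Fin n → ℂ)), IsAlgSet W →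
    {X | IsAtypComp j W X ∧ ∀ X', IsAtypComp j W X' → X ⊆ X' → X = X'}.Finite

/-! ### `j`-derivations, `jcl`, `C_j`, `dim^j` -/

/-- A `j`-derivation on `ℂ`. -/
def IsJDeriv (j : ℂ → ℂ) (D : ℂ → ℂ) : Prop :=
  (∀ a b : ℂ, D (a + b) = D a + D b) ∧
  (∀ a b : ℂ, D (a * b) = a * D b + b * D a) ∧
  (∀ z ∈ HH, ∀ k : ℕ, D (deriv^[k] j z) = deriv^[k + 1] j z * D z)

/-- The `j`-closure of a subset of `ℂ`. -/
def jcl (j : ℂ → ℂ) (A : Set ℂ) : Set ℂ :=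
  {x | ∀ D : ℂ → ℂ, IsJDeriv j D → (∀ a ∈ A, D a = 0) → D x = 0}

/-- `C_j = jcl(∅)`. -/
def Cj (j : ℂ → ℂ) : Set ℂ := jcl j ∅

/-- `dim^j(A|B) ≥ n`. -/
def dimjGE (j : ℂ → ℂ) (A B : Set ℂ) (n : ℕ) : Prop :=
  ∃ (a : Fin n → ℂ) (D : Fin n → ℂ → ℂ),
    (∀ i, a i ∈ jcl j A) ∧
    (∀ i, IsJDeriv j (D i) ∧ ∀ b ∈ B, D i b = 0) ∧
    (∀ i k, D i (a k) = if i = k then 1 else 0)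

/-- `dim^j(A|B)`, the relative dimension in the pregeometry `jcl`. -/
def dimj (j : ℂ → ℂ) (A B : Set ℂ) : ℕ := sSup {n | dimjGE j A B n}

/-- `V ⊆ ℂⁿ × Y(1)ⁿ` (broad) has no `C_j`-factors. -/
def NoCjFactors {n : ℕ} (j : ℂ → ℂ) (V : Set ((Fin n ⊕ Fin n) → ℂ)) : Prop :=
  ∀ (ℓ : ℕ) (i : Fin ℓ → Fin n), 1 ≤ ℓ → StrictMono i →
    ℓ < adim (prSum i '' V) ∨
    (adim (prSum i '' V) = ℓ ∧ ¬ IsAlgSetOver (Cj j) (zcl (prSum i '' V)))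

/-- A tuple `t ∈ ℍ^m` is convenient for `j`:
`tr.deg_ℚ ℚ(t, J(t)) = 3 dim_G(t|Σ) + dim^j(t)`. -/
def ConvenientTuple (j : ℂ → ℂ) {m : ℕ} (t : Fin m → ℂ) : Prop :=
  (∀ i, t i ∈ HH) ∧
  trdegF ⊥ (fun p : Fin 4 × Fin m =>
      ![t, j ∘ t, deriv j ∘ t, deriv (deriv j) ∘ t] p.1 p.2)
    = 3 * dimG t SigmaSet + dimj j (Set.range t) ∅

/-! ### Iterates of `j` -/

/-- The iterates of `j`: `jIt j 0 = id`, `jIt j (n+1) = j ∘ jIt j n`; so `j_n = jIt j n`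
for `n ≥ 1`. -/
def jIt (j : ℂ → ℂ) : ℕ → ℂ → ℂ
  | 0 => id
  | n + 1 => j ∘ jIt j n

/-- The domain `ℍ_n` of `j_n`: `ℍ₁ = ℍ`, `ℍ_{n+1} = {z ∈ ℍ_n : j_n(z) ∈ ℍ}`. -/
def HHn (j : ℂ → ℂ) : ℕ → Set ℂ
  | 0 => Set.univ
  | n + 1 => {z ∈ HHn j n | jIt j n z ∈ HH}

/-! ### The space `ℂⁿ × Y₂(1)ⁿ` with derivatives -/

/-- The projection `PR_i : ℂⁿ × Y₂(1)ⁿ → ℂ^ℓ × Y₂(1)^ℓ`. -/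
def prJ {n ℓ : ℕ} (i : Fin ℓ → Fin n) (v : (Fin n ⊕ Fin n × Fin 3) → ℂ) :
    (Fin ℓ ⊕ Fin ℓ × Fin 3) → ℂ :=
  Sum.elim (fun k => v (Sum.inl (i k))) (fun p => v (Sum.inr (i p.1, p.2)))

/-- `V ⊆ ℂⁿ × Y₂(1)ⁿ` is `J`-broad: `dim PR_i(V) ≥ 3ℓ` for all `i`. -/
def JBroad {n : ℕ} (V : Set ((Fin n ⊕ Fin n × Fin 3) → ℂ)) : Prop :=
  ∀ (ℓ : ℕ) (i : Fin ℓ → Fin n), 1 ≤ ℓ → StrictMono i → 3 * ℓ ≤ adim (prJ i '' V)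

/-- `V ⊆ ℂⁿ × Y₂(1)ⁿ` is `J`-free. -/
def JFree {n : ℕ} (j : ℂ → ℂ) (V : Set ((Fin n ⊕ Fin n × Fin 3) → ℂ)) : Prop :=
  NoConstCoord V ∧
  (∀ M : Set (Fin n → ℂ), IsMoebiusRat M → M ≠ Set.univ →
    ¬ V ⊆ {v | (fun k => v (Sum.inl k)) ∈ M}) ∧
  (∀ T : Set (Fin n → ℂ), IsSpecial j T → T ≠ Set.univ →
    ¬ V ⊆ {v | (fun k => v (Sum.inr (k, 0))) ∈ T})

/-- The graph `E_Jⁿ ⊆ ℂⁿ × Y₂(1)ⁿ` of `J = (j, j′, j″)`. -/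
def EJ (j : ℂ → ℂ) (n : ℕ) : Set ((Fin n ⊕ Fin n × Fin 3) → ℂ) :=
  {v | (∀ k, v (Sum.inl k) ∈ HH) ∧ ∀ k : Fin n,
      v (Sum.inr (k, 0)) = j (v (Sum.inl k)) ∧
      v (Sum.inr (k, 1)) = deriv j (v (Sum.inl k)) ∧
      v (Sum.inr (k, 2)) = deriv (deriv j) (v (Sum.inl k))}

/-- `V ⊆ ℂⁿ × Y₂(1)ⁿ` (J-broad) has no `C_j`-factors. -/
def NoCjFactorsJ {n : ℕ} (j : ℂ → ℂ) (V : Set ((Fin n ⊕ Fin n × Fin 3) → ℂ)) : Prop :=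
  ∀ (ℓ : ℕ) (i : Fin ℓ → Fin n), 1 ≤ ℓ → StrictMono i →
    3 * ℓ < adim (prJ i '' V) ∨
    (adim (prJ i '' V) = 3 * ℓ ∧ ¬ IsAlgSetOver (Cj j) (zcl (prJ i '' V)))

theorem bddAbove_algebraicIndepOn_card (K : Subfield ℂ) {ι : Type*} [Fintype ι] (v : ι → ℂ) :
    BddAbove {k : ℕ | ∃ t : Finset ι, t.card = k ∧ AlgebraicIndependent K (fun i : t => v i.1)} :=
  ⟨Fintype.card ι, by rintro _ ⟨t, rfl, -⟩; exact t.card_le_univ⟩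

theorem card_le_trdegF {K : Subfield ℂ} {ι : Type*} [Fintype ι] {v : ι → ℂ} {t : Finset ι}
    (ht : AlgebraicIndepOn K v (t : Set ι)) : t.card ≤ trdegF K v :=
  le_csSup (bddAbove_algebraicIndepOn_card K v) ⟨t, rfl, ht⟩

theorem exists_card_eq_trdegF (K : Subfield ℂ) {ι : Type*} [Fintype ι] (v : ι → ℂ) :
    ∃ t : Finset ι, t.card = trdegF K v ∧ AlgebraicIndepOn K v (t : Set ι) := by
  refine Nat.sSup_mem (s := {k : ℕ | ∃ t : Finset ι, t.card = k ∧
    AlgebraicIndependent K (fun i : t => v i.1)}) ⟨0, ∅, rfl, ?_⟩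
    (bddAbove_algebraicIndepOn_card K v)
  rw [algebraicIndependent_empty_type_iff]
  exact FaithfulSMul.algebraMap_injective K ℂ

theorem injOn_of_algebraicIndepOn {K : Subfield ℂ} {ι κ : Type*} {v : ι → ℂ} {f : κ → ι}
    {t : Set κ} (ht : AlgebraicIndepOn K (v ∘ f) t) : Set.InjOn f t := by
  intro a ha b hb hab
  have := ht.injective (a₁ := ⟨a, ha⟩) (a₂ := ⟨b, hb⟩) (by simp [hab])
  simpa using this

theorem algebraicIndepOn_image_of_comp {K : Subfield ℂ} {ι κ : Type*} [DecidableEq ι]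
    {v : ι → ℂ} {f : κ → ι} {t : Finset κ} (ht : AlgebraicIndepOn K (v ∘ f) (t : Set κ)) :
    AlgebraicIndepOn K v ((t.image f : Finset ι) : Set ι) ∧ (t.image f).card = t.card := by
  have hinj := injOn_of_algebraicIndepOn ht
  refine ⟨?_, Finset.card_image_of_injOn hinj⟩
  rw [Finset.coe_image]
  refine (algebraicIndependent_equiv' (Equiv.Set.imageOfInjOn f (t : Set κ) hinj) ?_).1 ht
  ext i
  rfl

theorem trdegF_comp_le (K : Subfield ℂ) {ι κ : Type*} [Fintype ι] [Fintype κ]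
    (v : ι → ℂ) (f : κ → ι) : trdegF K (v ∘ f) ≤ trdegF K v := by
  obtain ⟨t, ht, hi⟩ := exists_card_eq_trdegF K (v ∘ f)
  classical
  obtain ⟨h1, h2⟩ := algebraicIndepOn_image_of_comp hi
  exact ht ▸ h2 ▸ card_le_trdegF h1

theorem card_le_card_of_algebraicIndepOn {K : Subfield ℂ} {ι : Type*} {v : ι → ℂ} {t : Finset ι}
    (ht : AlgebraicIndepOn K v (t : Set ι)) (Y : Finset ℂ)
    (h : ∀ i ∈ t, IsAlgebraic (Algebra.adjoin K (Y : Set ℂ)) (v i)) : t.card ≤ Y.card := by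
  classical
  have hinj : Set.InjOn v (t : Set ι) := injOn_of_algebraicIndepOn (v := id) (f := v) ht
  let M := AlgebraicIndependent.matroid K ℂ
  have hind : M.Indep ((t.image v : Finset ℂ) : Set ℂ) := by
    rw [AlgebraicIndependent.matroid_indep_iff, Finset.coe_image]
    exact AlgebraicIndependent.image ht
  have hsub : ((t.image v : Finset ℂ) : Set ℂ) ⊆ M.closure (Y : Set ℂ) := by
    rw [AlgebraicIndependent.matroid_closure_eq]
    intro a ha
    obtain ⟨i, hi, rfl⟩ := Finset.mem_image.1 ha
    exact h i hi
  rw [← Finset.card_image_of_injOn hinj]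
  have h1 := M.eRk_mono hsub
  rw [hind.eRk_eq_encard, M.eRk_closure_eq] at h1
  have h2 := h1.trans (M.eRk_le_encard _)
  rw [Set.encard_coe_eq_coe_finsetCard, Set.encard_coe_eq_coe_finsetCard] at h2
  exact_mod_cast h2

theorem algebraicIndepOn_union {K : Subfield ℂ} {ι : Type*} {v : ι → ℂ} {s t : Finset ι}
    [DecidableEq ι] (hs : AlgebraicIndepOn (⊥ : Subfield ℂ) v (s : Set ι))
    (hsK : ∀ i ∈ s, v i ∈ K) (ht : AlgebraicIndepOn K v (t : Set ι)) :
    AlgebraicIndepOn (⊥ : Subfield ℂ) v ((s ∪ t : Finset ι) : Set ι) ∧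
      (s ∪ t).card = s.card + t.card := by
  have hdisj : Disjoint s t := by
    rw [Finset.disjoint_left]
    intro i hi hit
    exact ht.transcendental ⟨i, hit⟩ (isAlgebraic_algebraMap (⟨v i, hsK i hi⟩ : K))
  refine ⟨?_, Finset.card_union_of_disjoint hdisj⟩
  let _ : Algebra (⊥ : Subfield ℂ) K := (Subfield.inclusion bot_le).toAlgebra
  have : IsScalarTower (⊥ : Subfield ℂ) K ℂ := .of_algebraMap_eq fun x => rfl
  have h := AlgebraicIndependent.sumElim_of_tower (S := K) hs (by
    rintro _ ⟨i, rfl⟩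
    exact ⟨⟨v i, hsK i i.2⟩, rfl⟩) ht
  have hd : Disjoint (t : Set ι) (s : Set ι) := by exact_mod_cast hdisj.symm
  rw [Finset.coe_union, Set.union_comm]
  refine (algebraicIndependent_equiv' (Equiv.Set.union hd) ?_).2 h
  ext ⟨i, hi | hi⟩
  · simp [Equiv.Set.union_apply_left hd (a := ⟨i, .inl hi⟩) hi]
  · simp [Equiv.Set.union_apply_right hd (a := ⟨i, .inr hi⟩) hi]

theorem denom_ne_zero {g : Matrix (Fin 2) (Fin 2) ℚ} (hg : 0 < g.det) {x : ℂ} (hx : x ∈ HH) :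
    (g 1 0 : ℂ) * x + g 1 1 ≠ 0 := by
  intro h
  have him := congrArg Complex.im h
  have hre := congrArg Complex.re h
  simp at him hre
  have hx' : x.im ≠ 0 := ne_of_gt hx
  have h10 : g 1 0 = 0 := by simpa [hx'] using him
  have h11 : g 1 1 = 0 := by simpa [h10] using hre
  rw [Matrix.det_fin_two, h10, h11] at hg
  simp at hg

theorem moeb_qmat_eq_iff {g : Matrix (Fin 2) (Fin 2) ℚ} (hg : 0 < g.det) {x y : ℂ} (hx : x ∈ HH) :
    moeb (qmat g) x = y ↔ y * (g 1 0 * x + g 1 1) - (g 0 0 * x + g 0 1) = 0 := by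
  simp only [moeb, qmat, Matrix.map_apply]
  rw [div_eq_iff (denom_ne_zero hg hx), sub_eq_zero, eq_comm]

theorem moeb_mem_HH {g : Matrix (Fin 2) (Fin 2) ℚ} (hg : 0 < g.det) {x : ℂ} (hx : x ∈ HH) :
    moeb (qmat g) x ∈ HH := by
  have hd := denom_ne_zero hg hx
  have hx' : 0 < x.im := hx
  have hdet : (0 : ℝ) < (g 0 0 * g 1 1 - g 0 1 * g 1 0 : ℚ) := by
    rw [Matrix.det_fin_two] at hg; exact_mod_cast hg
  have hn : 0 < Complex.normSq ((g 1 0 : ℂ) * x + g 1 1) := Complex.normSq_pos.2 hd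
  change 0 < (moeb (qmat g) x).im
  have : (moeb (qmat g) x).im =
      ((g 0 0 * g 1 1 - g 0 1 * g 1 0 : ℚ) : ℝ) * x.im /
        Complex.normSq ((g 1 0 : ℂ) * x + g 1 1) := by
    simp only [moeb, qmat, Matrix.map_apply, Complex.div_im]
    rw [← sub_div]
    congr 1
    simp
    ring
  rw [this]
  positivity

theorem moeb_qmat_mul (g : Matrix (Fin 2) (Fin 2) ℚ) {h : Matrix (Fin 2) (Fin 2) ℚ} (hh : 0 < h.det)
    {x : ℂ} (hx : x ∈ HH) :
    moeb (qmat (g * h)) x = moeb (qmat g) (moeb (qmat h) x) := by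
  have h1 := denom_ne_zero hh hx
  have key : ∀ a b : ℚ, ((a * h 0 0 + b * h 1 0 : ℚ) : ℂ) * x + ((a * h 0 1 + b * h 1 1 : ℚ) : ℂ) =
      ((h 1 0 : ℂ) * x + h 1 1) * (a * ((h 0 0 * x + h 0 1) / (h 1 0 * x + h 1 1)) + b) := by
    intro a b
    rw [mul_add, mul_left_comm, mul_div_cancel₀ _ h1]
    push_cast
    ring
  simp only [moeb, qmat, Matrix.map_apply, Matrix.mul_apply, Fin.sum_univ_two]
  rw [key, key, mul_div_mul_left _ _ h1]

theorem GRel.refl (x : ℂ) : GRel x x := ⟨1, by simp, by simp [moeb, qmat]⟩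

theorem GRel.mem_HH {x y : ℂ} (hx : x ∈ HH) (h : GRel x y) : y ∈ HH := by
  obtain ⟨g, hg, rfl⟩ := h
  exact moeb_mem_HH hg hx

theorem GRel.trans {x y z : ℂ} (hx : x ∈ HH) (hxy : GRel x y) (hyz : GRel y z) : GRel x z := by
  obtain ⟨g, hg, rfl⟩ := hxy
  obtain ⟨h, hh, rfl⟩ := hyz
  exact ⟨h * g, by rw [Matrix.det_mul]; positivity, moeb_qmat_mul h hg hx⟩

theorem GRel.symm {x y : ℂ} (hx : x ∈ HH) (h : GRel x y) : GRel y x := by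
  obtain ⟨g, hg, rfl⟩ := h
  have ha : 0 < g.adjugate.det := by simpa [Matrix.det_adjugate] using hg
  refine ⟨g.adjugate, ha, ?_⟩
  rw [← moeb_qmat_mul _ hg hx, Matrix.adjugate_mul]
  have : (g.det : ℂ) ≠ 0 := by exact_mod_cast hg.ne'
  simp [moeb, qmat, this]

theorem Gorb_eq_iff {x y : ℂ} (hx : x ∈ HH) : Gorb x = Gorb y ↔ GRel x y := by
  constructor
  · intro h
    have : y ∈ Gorb y := GRel.refl y
    rwa [← h] at this
  · intro h
    ext z
    exact ⟨fun hz => (h.symm hx).trans (h.mem_HH hx) hz, fun hz => h.trans hx hz⟩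

theorem scalar_of_moeb_qmat_self {g : Matrix (Fin 2) (Fin 2) ℚ} (hg : 0 < g.det) {x : ℂ}
    (hx : x ∈ HH) (hxS : x ∉ SigmaSet) (h : moeb (qmat g) x = x) :
    g 1 0 = 0 ∧ g 0 1 = 0 ∧ g 1 1 = g 0 0 := by
  rw [moeb_qmat_eq_iff hg hx] at h
  by_contra hne
  apply hxS
  refine ⟨hx, ?_⟩
  set p : Polynomial ℚ := Polynomial.C (g 1 0) * Polynomial.X ^ 2 +
    Polynomial.C (g 1 1 - g 0 0) * Polynomial.X + Polynomial.C (-g 0 1) with hp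
  have hp0 : p ≠ 0 := by
    intro h0
    apply hne
    have c0 := congrArg (fun q => Polynomial.coeff q 0) h0
    have c1 := congrArg (fun q => Polynomial.coeff q 1) h0
    have c2 := congrArg (fun q => Polynomial.coeff q 2) h0
    simp [hp, Polynomial.coeff_X, Polynomial.coeff_C] at c0 c1 c2
    exact ⟨c2, c0, sub_eq_zero.1 c1⟩
  have hroot : Polynomial.aeval x p = 0 := by
    simp only [hp, map_add, map_mul, Polynomial.aeval_C, Polynomial.aeval_X, map_pow]
    simp
    linear_combination h
  have hint : IsIntegral ℚ x := isAlgebraic_iff_isIntegral.1 ⟨p, hp0, hroot⟩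
  have hle : (minpoly ℚ x).natDegree ≤ 2 :=
    (Polynomial.natDegree_le_of_dvd (minpoly.dvd ℚ x hroot) hp0).trans
      Polynomial.natDegree_quadratic_le
  have hpos := minpoly.natDegree_pos hint
  have hne1 : (minpoly ℚ x).natDegree ≠ 1 := by
    intro h1
    obtain ⟨q, rfl⟩ := minpoly.natDegree_eq_one_iff.1 h1
    have : (0 : ℝ) < ((algebraMap ℚ ℂ) q).im := hx
    simp at this
  omega

theorem dimG_eq_card {ι : Type*} [Fintype ι] {w : ι → ℂ} (hw : ∀ i, w i ∈ HH)
    (hpair : ∀ i k, GRel (w i) (w k) → i = k) (hS : ∀ i, ∀ c ∈ SigmaSet, ¬ GRel (w i) c) :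
    dimG w SigmaSet = Fintype.card ι := by
  have : {S : Set ℂ | ∃ i : ι, S = Gorb (w i) ∧ ∀ c ∈ SigmaSet, ¬ GRel (w i) c} =
      Set.range (fun i => Gorb (w i)) := by
    ext S
    simp only [Set.mem_ofPred_eq, Set.mem_range]
    exact ⟨fun ⟨i, h, _⟩ => ⟨i, h.symm⟩, fun ⟨i, h⟩ => ⟨i, h.symm, hS i⟩⟩
  rw [dimG, this, ← Set.image_univ, Set.ncard_image_of_injective, Set.ncard_univ,
    Nat.card_eq_fintype_card]
  exact fun i k h => hpair i k ((Gorb_eq_iff (hw i)).1 h)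

theorem exists_orbit_representatives {ι : Type*} [Finite ι] {z : ι → ℂ} (hz : ∀ i, z i ∈ HH) :
    ∃ f : Fin (dimG z SigmaSet) → ι, (∀ i k, GRel (z (f i)) (z (f k)) → i = k) ∧
      (∀ i, ∀ c ∈ SigmaSet, ¬ GRel (z (f i)) c) ∧
      ∀ l, (∃ i, GRel (z (f i)) (z l)) ∨ ∃ c ∈ SigmaSet, GRel (z l) c := by
  set O : Set (Set ℂ) := {S | ∃ i : ι, S = Gorb (z i) ∧ ∀ c ∈ SigmaSet, ¬ GRel (z i) c} with hO
  have hfin : O.Finite := (Set.finite_range (fun i => Gorb (z i))).subset (by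
    rintro _ ⟨i, rfl, -⟩; exact ⟨i, rfl⟩)
  have : Finite O := hfin
  let e : Fin (dimG z SigmaSet) ≃ O := (Finite.equivFinOfCardEq (by rfl)).symm
  choose f hf hfS using fun i => (e i).2
  refine ⟨f, fun i k h => ?_, hfS, fun l => ?_⟩
  · rw [← Gorb_eq_iff (hz _), ← hf i, ← hf k] at h
    exact e.injective (Subtype.ext h)
  · by_cases h : ∀ c ∈ SigmaSet, ¬ GRel (z l) c
    · left
      refine ⟨e.symm ⟨Gorb (z l), l, rfl, h⟩, ?_⟩
      rw [← Gorb_eq_iff (hz _), ← hf]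
      simp
    · right
      push Not at h
      exact h

/-- The tuple `(z, j(z), j′(z), j″(z))`. -/
def jTuple (j : ℂ → ℂ) {ι : Type*} (z : ι → ℂ) (p : Fin 4 × ι) : ℂ :=
  ![z, j ∘ z, deriv j ∘ z, deriv (deriv j) ∘ z] p.1 p.2

theorem jTuple_comp (j : ℂ → ℂ) {ι κ : Type*} (z : ι → ℂ) (f : κ → ι) :
    jTuple j (z ∘ f) = jTuple j z ∘ Prod.map id f := by
  ext ⟨a, i⟩
  fin_cases a <;> rfl

theorem MSCD.card_le {j : ℂ → ℂ} (h : MSCD j) {ι : Type*} [Fintype ι] {w : ι → ℂ}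
    (hw : ∀ i, w i ∈ HH) (hpair : ∀ i k, GRel (w i) (w k) → i = k)
    (hS : ∀ i, ∀ c ∈ SigmaSet, ¬ GRel (w i) c) :
    3 * Fintype.card ι ≤ trdegF ⊥ (jTuple j w) := by
  let e := (Fintype.equivFin ι).symm
  have h1 := h _ (w ∘ e) (fun i => hw _)
  rw [dimG_eq_card (w := w ∘ e) (fun i => hw _) (fun i k hik => e.injective (hpair _ _ hik))
    (fun i => hS _), Fintype.card_fin] at h1
  refine h1.trans ?_
  change trdegF ⊥ (jTuple j (w ∘ e)) ≤ _
  rw [jTuple_comp]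
  exact trdegF_comp_le _ _ _

theorem jTuple_zero (j : ℂ → ℂ) {ι : Type*} (z : ι → ℂ) (i : ι) : jTuple j z (0, i) = z i := rfl

theorem jTuple_succ (j : ℂ → ℂ) {ι : Type*} (z : ι → ℂ) (k : Fin 3) (i : ι) :
    jTuple j z (k.succ, i) = deriv^[k] j (z i) := by
  fin_cases k <;> rfl

/-- The `ℂ`-vector space of `j`-derivations. -/
def jDerivations (j : ℂ → ℂ) : Submodule ℂ (ℂ → ℂ) where
  carrier := {D | IsJDeriv j D}
  add_mem' {D E} hD hE := by
    refine ⟨fun a b => ?_, fun a b => ?_, fun z hz k => ?_⟩ <;> simp only [Pi.add_apply]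
    · rw [hD.1, hE.1]; ring
    · rw [hD.2.1, hE.2.1]; ring
    · rw [hD.2.2 z hz, hE.2.2 z hz]; ring
  zero_mem' := ⟨by simp, by simp, by simp⟩
  smul_mem' c D hD := by
    refine ⟨fun a b => ?_, fun a b => ?_, fun z hz k => ?_⟩ <;>
      simp only [Pi.smul_apply, smul_eq_mul]
    · rw [hD.1]; ring
    · rw [hD.2.1]; ring
    · rw [hD.2.2 z hz]; ring

namespace IsJDeriv

variable {j D : ℂ → ℂ}

theorem map_zero (h : IsJDeriv j D) : D 0 = 0 := by simpa using h.1 0 0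

theorem map_one (h : IsJDeriv j D) : D 1 = 0 := by simpa using h.2.1 1 1

/-- The field of constants of a `j`-derivation. -/
def constants (h : IsJDeriv j D) : Subfield ℂ where
  carrier := {x | D x = 0}
  mul_mem' {a b} ha hb := by
    simp only [Set.mem_ofPred_eq] at *
    simp [h.2.1, ha, hb]
  one_mem' := h.map_one
  add_mem' {a b} ha hb := by
    simp only [Set.mem_ofPred_eq] at *
    simp [h.1, ha, hb]
  zero_mem' := h.map_zero
  neg_mem' {a} ha := by
    have := h.1 a (-a)
    simp only [Set.mem_ofPred_eq] at *
    simpa [ha, h.map_zero] using this.symm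
  inv_mem' a ha := by
    simp only [Set.mem_ofPred_eq] at *
    rcases eq_or_ne a 0 with rfl | ha0
    · simpa using h.map_zero
    · have := h.2.1 a a⁻¹
      rw [mul_inv_cancel₀ ha0, h.map_one, ha] at this
      simpa [ha0] using this.symm

theorem mem_constants (h : IsJDeriv j D) {x : ℂ} : x ∈ h.constants ↔ D x = 0 := Iff.rfl

/-- A `j`-derivation as a derivation over its field of constants. -/
def toDerivation (h : IsJDeriv j D) : Derivation h.constants ℂ ℂ where
  toFun := D
  map_add' := h.1
  map_smul' c x := by
    have hc : D c = 0 := c.2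
    simp [Subfield.smul_def, h.2.1, hc]
  map_one_eq_zero' := h.map_one
  leibniz' a b := by simp [h.2.1]

@[simp] theorem toDerivation_apply (h : IsJDeriv j D) (x : ℂ) : h.toDerivation x = D x := rfl

theorem eq_zero_of_isAlgebraic (h : IsJDeriv j D) {x : ℂ} (hx : IsAlgebraic h.constants x) :
    D x = 0 := by
  have hint := isAlgebraic_iff_isIntegral.1 hx
  have h1 := h.toDerivation.map_aeval (minpoly h.constants x) x
  rw [minpoly.aeval, _root_.map_zero, h.toDerivation_apply, smul_eq_mul, eq_comm,
    mul_eq_zero] at h1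
  exact h1.resolve_left
    ((minpoly.irreducible hint).separable.aeval_derivative_ne_zero (minpoly.aeval _ _))

theorem eq_zero_of_mem_SigmaSet (h : IsJDeriv j D) {x : ℂ} (hx : x ∈ SigmaSet) : D x = 0 := by
  refine h.eq_zero_of_isAlgebraic ?_
  have : IsIntegral ℚ x := by
    by_contra hn
    have := hx.2
    rw [minpoly.eq_zero hn] at this
    simp at this
  exact this.isAlgebraic.extendScalars (RingHom.injective _)

theorem eq_zero_of_GRel (h : IsJDeriv j D) {x y : ℂ} (hxy : GRel x y) (hx : D x = 0) :
    D y = 0 := by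
  obtain ⟨g, -, rfl⟩ := hxy
  have hq : ∀ q : ℚ, (q : ℂ) ∈ h.constants := fun q => SubfieldClass.ratCast_mem _ q
  rw [← h.mem_constants] at hx ⊢
  exact div_mem (add_mem (mul_mem (hq _) hx) (hq _)) (add_mem (mul_mem (hq _) hx) (hq _))

theorem jTuple_mem_constants (h : IsJDeriv j D) {ι : Type*} {w : ι → ℂ} {i : ι} (hw : w i ∈ HH)
    (h0 : D (w i) = 0) (k : Fin 4) : jTuple j w (k, i) ∈ h.constants := by
  refine Fin.cases ?_ (fun k => ?_) k
  · exact h0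
  · rw [jTuple_succ, h.mem_constants, h.2.2 _ hw, h0, mul_zero]

end IsJDeriv

/-- The space of values of `j`-derivations at a tuple. -/
def jTangent (j : ℂ → ℂ) {ι : Type*} (w : ι → ℂ) : Submodule ℂ (ι → ℂ) :=
  (jDerivations j).map (LinearMap.funLeft ℂ ℂ w)

theorem mem_jTangent {j : ℂ → ℂ} {ι : Type*} {w : ι → ℂ} {v : ι → ℂ} :
    v ∈ jTangent j w ↔ ∃ D, IsJDeriv j D ∧ D ∘ w = v := Iff.rfl

theorem dimj_le_finrank_jTangent {j : ℂ → ℂ} {ι : Type*} [Finite ι] {w : ι → ℂ} {A : Set ℂ}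
    (hA : ∀ D, IsJDeriv j D → (∀ i, D (w i) = 0) → ∀ a ∈ A, D a = 0) :
    dimj j A ∅ ≤ Module.finrank ℂ (jTangent j w) := by
  refine csSup_le' ?_
  rintro n ⟨a, D, ha, hD, hDa⟩
  let v : Fin n → jTangent j w := fun i => ⟨D i ∘ w, mem_jTangent.2 ⟨D i, (hD i).1, rfl⟩⟩
  have hv : LinearIndependent ℂ v := by
    rw [Fintype.linearIndependent_iff]
    intro c hc k
    have hE : ∑ i, c i • D i ∈ jDerivations j :=
      Submodule.sum_mem _ fun i _ => Submodule.smul_mem _ _ (hD i).1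
    have h0 : ∀ l, (∑ i, c i • D i) (w l) = 0 := by
      intro l
      have := congrFun (congrArg Subtype.val hc) l
      simpa [v] using this
    have := ha k _ hE (hA _ hE h0)
    simpa [hDa] using this
  simpa using hv.fintype_card_le_finrank

theorem finrank_jTangent_le_add_one {j D : ℂ → ℂ} (hD : IsJDeriv j D) {ι : Type*} {w : ι → ℂ}
    {c s : Finset ι} (hcs : c ⊆ s) (hDc : ∀ i ∈ c, D (w i) = 0)
    (hmax : ∀ E, IsJDeriv j E → (∀ i ∈ c, E (w i) = 0) → ∃ a : ℂ, ∀ i ∈ s, a * D (w i) = E (w i)) :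
    Module.finrank ℂ (jTangent j (fun i : s => w i)) ≤
      Module.finrank ℂ (jTangent j (fun i : c => w i)) + 1 := by
  let R := LinearMap.funLeft ℂ ℂ (fun i : c => (⟨i, hcs i.2⟩ : s))
  let R' := R.domRestrict (jTangent j (fun i : s => w i))
  have h1 : Module.finrank ℂ (LinearMap.range R') ≤
      Module.finrank ℂ (jTangent j (fun i : c => w i)) := by
    refine Submodule.finrank_mono ?_
    rintro _ ⟨⟨_, E, hE, rfl⟩, rfl⟩
    exact ⟨E, hE, rfl⟩
  have h2 : Module.finrank ℂ (LinearMap.ker R') ≤ 1 := by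
    refine finrank_le_one (⟨⟨_, D, hD, rfl⟩, ?_⟩ : LinearMap.ker R') ?_
    · rw [LinearMap.mem_ker]
      ext i
      exact hDc i i.2
    · rintro ⟨⟨_, E, hE, rfl⟩, hker⟩
      obtain ⟨a, ha⟩ := hmax E hE fun i hi => congrFun (LinearMap.mem_ker.1 hker) ⟨i, hi⟩
      refine ⟨a, Subtype.ext (Subtype.ext ?_)⟩
      ext i
      exact ha i i.2
  have h3 := LinearMap.finrank_range_add_finrank_ker R'
  omega

section

open MvPolynomial Topology
open scoped ContDiff

theorem isOpen_HH : IsOpen HH := isOpen_lt continuous_const Complex.continuous_im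

/-- The infinite jet `(z, j(z), j′(z), …)` of a tuple. -/
def jetVal (j : ℂ → ℂ) {ι : Type*} (z : ι → ℂ) : ι × ℕ → ℂ
  | (i, 0) => z i
  | (i, k + 1) => deriv^[k] j (z i)

theorem jetVal_comp (j : ℂ → ℂ) {ι : Type*} (z : ι → ℂ) (p : Fin 4 × ι) :
    jetVal j z (p.2, p.1) = jTuple j z p := by
  obtain ⟨k, i⟩ := p
  refine Fin.cases rfl (fun k => ?_) k
  exact (jTuple_succ j z k i).symm

open Classical in
/-- The derivation on jet polynomials lifting partial differentiation in the `i`-th coordinate. -/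
def jetDeriv (K : Subfield ℂ) {ι : Type*} (i : ι) :
    Derivation K (MvPolynomial (ι × ℕ) K) (MvPolynomial (ι × ℕ) K) :=
  mkDerivation K fun p => if p.1 = i then (if p.2 = 0 then 1 else X (i, p.2 + 1)) else 0

theorem jetDeriv_X_zero (K : Subfield ℂ) {ι : Type*} [DecidableEq ι] (i l : ι) :
    jetDeriv K i (X (l, 0)) = if l = i then 1 else 0 := by
  simp [jetDeriv]

theorem jetDeriv_X_succ (K : Subfield ℂ) {ι : Type*} [DecidableEq ι] (i l : ι) (k : ℕ) :
    jetDeriv K i (X (l, k + 1)) = if l = i then X (l, k + 2) else 0 := by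
  simp only [jetDeriv, mkDerivation_X]
  by_cases h : l = i
  · subst h; simp
  · simp [h]

section

variable {j : ℂ → ℂ} {ι : Type*} [Fintype ι]

theorem IsJDeriv.apply_aeval_jetVal {D : ℂ → ℂ} (hD : IsJDeriv j D) {z : ι → ℂ}
    (hz : ∀ i, z i ∈ HH) (p : MvPolynomial (ι × ℕ) hD.constants) :
    D (aeval (jetVal j z) p) =
      ∑ i, D (z i) * aeval (jetVal j z) (jetDeriv hD.constants i p) := by
  classical
  induction p using MvPolynomial.induction_on with
  | C a => simpa using! hD.mem_constants.1 a.2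
  | add p q hp hq => simp [hD.1, hp, hq, mul_add, Finset.sum_add_distrib]
  | mul_X p n hp =>
    have hX : D (jetVal j z n) =
        ∑ i, D (z i) * aeval (jetVal j z) (jetDeriv hD.constants i (X n)) := by
      obtain ⟨l, _ | k⟩ := n
      · simp [jetDeriv_X_zero, apply_ite (aeval (jetVal j z)), jetVal]
      · simp [jetDeriv_X_succ, apply_ite (aeval (jetVal j z)), jetVal, hD.2.2 _ (hz l), mul_comm]
    rw [map_mul, aeval_X, hD.2.1, hp, hX, Finset.mul_sum, Finset.mul_sum, ← Finset.sum_add_distrib]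
    refine Finset.sum_congr rfl fun i _ => ?_
    simp only [Derivation.leibniz, smul_eq_mul, map_add, map_mul, aeval_X]
    ring

theorem analyticOnNhd_iterate_deriv (hj : DifferentiableOn ℂ j HH) (k : ℕ) :
    AnalyticOnNhd ℂ (deriv^[k] j) HH :=
  (hj.analyticOnNhd isOpen_HH).iterated_deriv k

/-- The continuous linear form on `ℂ^ι` with coefficients `c`. -/
def dotCLM (c : ι → ℂ) : (ι → ℂ) →L[ℂ] ℂ :=
  ∑ i, c i • (ContinuousLinearMap.proj i : (ι → ℂ) →L[ℂ] ℂ)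

@[simp]
theorem dotCLM_apply (c v : ι → ℂ) : dotCLM c v = ∑ i, c i * v i := by
  simp [dotCLM]

theorem hasStrictFDerivAt_aeval_jetVal (hj : DifferentiableOn ℂ j HH) (K : Subfield ℂ) {z : ι → ℂ}
    (hz : ∀ i, z i ∈ HH) (p : MvPolynomial (ι × ℕ) K) :
    HasStrictFDerivAt (fun y : ι → ℂ => aeval (jetVal j y) p)
      (dotCLM fun i => aeval (jetVal j z) (jetDeriv K i p)) z := by
  classical
  induction p using MvPolynomial.induction_on with
  | C a =>
    have h := hasStrictFDerivAt_const (𝕜 := ℂ) (algebraMap K ℂ a) z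
    simp only [aeval_C]
    refine h.congr_fderiv (ContinuousLinearMap.ext fun v => ?_)
    simp
  | add p q hp hq =>
    simp only [map_add]
    refine (hp.add hq).congr_fderiv (ContinuousLinearMap.ext fun v => ?_)
    simp [add_mul, Finset.sum_add_distrib]
  | mul_X p n hp =>
    have hX : HasStrictFDerivAt (fun y : ι → ℂ => jetVal j y n)
        (dotCLM fun i => aeval (jetVal j z) (jetDeriv K i (X n))) z := by
      obtain ⟨l, _ | k⟩ := n
      · refine (hasStrictFDerivAt_apply (𝕜 := ℂ) l z).congr_fderiv
          (ContinuousLinearMap.ext fun v => ?_)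
        simp [jetDeriv_X_zero, apply_ite (aeval (jetVal j z))]
      · have h1 := ((analyticOnNhd_iterate_deriv hj k) _ (hz l)).hasStrictDerivAt
        rw [← Function.iterate_succ_apply' deriv] at h1
        refine (h1.comp_hasStrictFDerivAt z (hasStrictFDerivAt_apply (𝕜 := ℂ) l z)).congr_fderiv
          (ContinuousLinearMap.ext fun v => ?_)
        simp [jetDeriv_X_succ, apply_ite (aeval (jetVal j z)), jetVal]
    simp only [map_mul, aeval_X]
    refine (hp.mul hX).congr_fderiv (ContinuousLinearMap.ext fun v => ?_)
    simp only [Derivation.leibniz, smul_eq_mul, map_add, map_mul, aeval_X, dotCLM_apply,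
      Finset.mul_sum, ← Finset.sum_add_distrib, _root_.add_apply,
      _root_.smul_apply]
    exact Finset.sum_congr rfl fun i _ => by ring

theorem analyticAt_aeval_jetVal (hj : DifferentiableOn ℂ j HH) (K : Subfield ℂ) {z : ι → ℂ}
    (hz : ∀ i, z i ∈ HH) (p : MvPolynomial (ι × ℕ) K) :
    AnalyticAt ℂ (fun y : ι → ℂ => aeval (jetVal j y) p) z := by
  induction p using MvPolynomial.induction_on with
  | C a => simpa using! analyticAt_const
  | add p q hp hq => simpa using! hp.add hq
  | mul_X p n hp =>
    have hX : AnalyticAt ℂ (fun y : ι → ℂ => jetVal j y n) z := by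
      have hproj : ∀ l, AnalyticAt ℂ (fun y : ι → ℂ => y l) z := fun l =>
        (ContinuousLinearMap.proj (R := ℂ) (φ := fun _ : ι => ℂ) l).analyticAt z
      obtain ⟨l, _ | k⟩ := n
      · exact hproj l
      · exact ((analyticOnNhd_iterate_deriv hj k) _ (hz l)).comp_of_eq (hproj l) rfl
    simpa using! hp.mul hX

end

theorem exists_biorthogonal_of_notMem_span {k ι : Type*} [Field k] [Fintype ι]
    {G : Set (ι → k)} {e : ι → k} (he : e ∉ Submodule.span k G) :
    ∃ (n : ℕ) (b B : Fin n → ι → k), (∀ l, b l ∈ G) ∧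
      (∀ x ∈ G, ∃ c : Fin n → k, x = ∑ l, c l • b l) ∧
      (∀ l l', ∑ i, b l' i * B l i = if l' = l then 1 else 0) ∧
      ∀ l, ∑ i, e i * B l i = 0 := by
  classical
  obtain ⟨s, hsG, hspan, hli⟩ := exists_linearIndependent k G
  have : Finite s := hli.finite
  obtain ⟨n, ⟨eqv'⟩⟩ := Finite.exists_equiv_fin s
  have eqv : Fin n ≃ s := eqv'.symm
  let b : Fin n → ι → k := fun l => (eqv l : ι → k)
  have hb : LinearIndependent k b := hli.comp _ eqv.injective
  have hrange : Set.range b = s := by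
    ext y
    refine ⟨by rintro ⟨l, rfl⟩; exact (eqv l).2, fun hy =>
      ⟨eqv.symm ⟨y, hy⟩, congrArg Subtype.val (eqv.apply_symm_apply _)⟩⟩
  have hopt : LinearIndependent k (fun o : Option (Fin n) => o.elim e b) := by
    rw [linearIndependent_option]
    refine ⟨hb, ?_⟩
    change e ∉ Submodule.span k (Set.range b)
    rwa [hrange, hspan]
  obtain ⟨φ, hφ⟩ := LinearMap.exists_leftInverse_of_injective
    (Fintype.linearCombination k (fun o : Option (Fin n) => o.elim e b))
    (LinearMap.ker_eq_bot.2 (linearIndependent_iff_injective_fintypeLinearCombination.1 hopt))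
  have hφo : ∀ o : Option (Fin n), φ (o.elim e b) = Pi.single o 1 := fun o => by
    have := LinearMap.congr_fun hφ (Pi.single o 1)
    rwa [LinearMap.comp_apply, Fintype.linearCombination_apply_single, one_smul] at this
  have hsum : ∀ (v : ι → k) l, ∑ i, v i * φ (Pi.single i 1) (some l) = φ v (some l) := by
    intro v l
    conv_rhs => rw [pi_eq_sum_univ' v, map_sum]
    simp only [map_smul, Finset.sum_apply, Pi.smul_apply, smul_eq_mul]
  refine ⟨n, b, fun l i => φ (Pi.single i 1) (some l), fun l => hsG (eqv l).2, ?_, ?_, ?_⟩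
  · intro x hx
    have : x ∈ Submodule.span k (Set.range b) := by
      rw [hrange, hspan]; exact Submodule.subset_span hx
    obtain ⟨c, hc⟩ := (Submodule.mem_span_range_iff_exists_fun k).1 this
    exact ⟨c, hc.symm⟩
  · intro l l'
    rw [hsum, show b l' = (some l').elim e b from rfl, hφo]
    simp [Pi.single_apply, eq_comm]
  · intro l
    rw [hsum, show e = (none : Option (Fin n)).elim e b from rfl, hφo]
    simp

theorem exists_biorthogonal_polynomials {K : Subfield ℂ} {σ ι : Type*} [Fintype ι] {x : σ → ℂ}
    {I : Set (MvPolynomial σ K)} {δ : ι → MvPolynomial σ K → MvPolynomial σ K} {a : ι → ℂ}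
    (ha : ∀ f ∈ I, ∑ i, a i * aeval x (δ i f) = 0) {τ : ι} (hτ : a τ ≠ 0) :
    ∃ (n : ℕ) (F : Fin n → MvPolynomial σ K) (B : Fin n → ι → ℂ), (∀ l, F l ∈ I) ∧
      (∀ l l', ∑ i, aeval x (δ i (F l')) * B l i = if l' = l then 1 else 0) ∧
      (∀ l, B l τ = 0) ∧
      ∀ f ∈ I, ∃ m, aeval x m ≠ 0 ∧ ∃ r : Fin n → MvPolynomial σ K,
        ∀ i, aeval x (m * δ i f) = aeval x (∑ l, r l * δ i (F l)) := by
  classical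
  let k := IntermediateField.adjoin K (Set.range x)
  have hk : ∀ p : MvPolynomial σ K, aeval x p ∈ k := fun p =>
    IntermediateField.algebra_adjoin_le_adjoin K (Set.range x)
      (by rw [Algebra.adjoin_range_eq_range_aeval]; exact ⟨p, rfl⟩)
  let grad : MvPolynomial σ K → ι → k := fun f i => ⟨aeval x (δ i f), hk _⟩
  have he : (Pi.single τ 1 : ι → k) ∉ Submodule.span k (grad '' I) := by
    intro h
    have hall : ∀ v ∈ Submodule.span k (grad '' I), ∑ i, a i * (v i : ℂ) = 0 := by
      intro v hv
      induction hv using Submodule.span_induction with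
      | mem v hv => obtain ⟨f, hf, rfl⟩ := hv; exact ha f hf
      | zero => simp
      | add v v' _ _ h h' => simp [mul_add, Finset.sum_add_distrib, h, h']
      | smul c v _ h =>
        simp only [Pi.smul_apply, smul_eq_mul, MulMemClass.coe_mul]
        rw [← mul_zero (c : ℂ), ← h, Finset.mul_sum]
        exact Finset.sum_congr rfl fun i _ => by ring
    have := hall _ h
    rw [Finset.sum_eq_single τ (fun i _ hi => by simp [hi]) (by simp)] at this
    simp [hτ] at this
  obtain ⟨n, b, B, hb, hspan, hB, hBe⟩ := exists_biorthogonal_of_notMem_span he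
  choose F hFI hF using hb
  refine ⟨n, F, fun l i => B l i, hFI, fun l l' => ?_, fun l => ?_, fun f hf => ?_⟩
  · have := congrArg (fun y : k => (y : ℂ)) (hB l l')
    simp only [← hF] at this
    rw [apply_ite (fun y : k => (y : ℂ))] at this
    simpa [grad] using this
  · have := hBe l
    rw [Finset.sum_eq_single τ (fun i _ hi => by simp [hi]) (by simp)] at this
    simpa using this
  · obtain ⟨c, hc⟩ := hspan _ ⟨f, hf, rfl⟩
    have hfrac : ∀ l, ∃ r s : MvPolynomial σ K,
        aeval x s ≠ 0 ∧ (c l : ℂ) * aeval x s = aeval x r := by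
      intro l
      obtain ⟨r, s, hrs⟩ := (IntermediateField.mem_adjoin_range_iff K x (c l : ℂ)).1 (c l).2
      by_cases hs : aeval x s = 0
      · exact ⟨0, 1, by simp, by rw [hrs, hs]; simp⟩
      · exact ⟨r, s, hs, by rw [hrs, div_mul_cancel₀ _ hs]⟩
    choose r s hs hrs using hfrac
    refine ⟨∏ l, s l, ?_, fun l => r l * ∏ l' ∈ Finset.univ.erase l, s l', fun i => ?_⟩
    · rw [map_prod]; exact Finset.prod_ne_zero_iff.2 fun l _ => hs l
    · have hci : aeval x (δ i f) = ∑ l, (c l : ℂ) * aeval x (δ i (F l)) := by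
        have := congrArg (fun y : ι → k => (y i : ℂ)) hc
        simpa [← hF, grad, Finset.sum_apply] using this
      rw [map_mul, hci, Finset.mul_sum, map_sum]
      refine Finset.sum_congr rfl fun l _ => ?_
      rw [← Finset.mul_prod_erase Finset.univ s (Finset.mem_univ l)]
      simp only [map_mul, ← hrs]
      ring

theorem exists_analytic_curve {ι : Type*} [Fintype ι] {n : ℕ} {Φ : Fin n → (ι → ℂ) → ℂ}
    {w a : ι → ℂ} {g B : Fin n → ι → ℂ} (hΦ : ∀ l, AnalyticAt ℂ (Φ l) w)
    (hg : ∀ l, HasFDerivAt (Φ l) (dotCLM (g l)) w) (h0 : ∀ l, Φ l w = 0)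
    (hB : ∀ l l', ∑ i, g l' i * B l i = if l' = l then 1 else 0)
    (ha : ∀ l, ∑ i, g l i * a i = 0) :
    ∃ u : ℂ → ι → ℂ, AnalyticAt ℂ u 0 ∧ u 0 = w ∧ HasDerivAt u a 0 ∧
      (∀ τ, (∀ l, B l τ = 0) → ∀ᶠ s in 𝓝 0, u s τ = w τ + s * a τ) ∧
      ∀ l, ∀ᶠ s in 𝓝 0, Φ l (u s) = 0 := by
  classical
  let H : (ι → ℂ) → ι → ℂ := fun z => z + ∑ l, (Φ l z - dotCLM (g l) (z - w)) • B l
  have hHw : H w = w := by simp [H, h0]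
  have hHan : AnalyticAt ℂ H w := by
    refine analyticAt_id.add (Finset.analyticAt_fun_sum _ fun l _ => ?_)
    exact ((hΦ l).sub (((dotCLM (g l)).analyticAt _).comp (analyticAt_id.sub analyticAt_const))).smul
      analyticAt_const
  have hHd : HasFDerivAt H ((ContinuousLinearEquiv.refl ℂ (ι → ℂ) : (ι → ℂ) →L[ℂ] ι → ℂ)) w := by
    have h1 : ∀ l, HasFDerivAt (fun z => (Φ l z - dotCLM (g l) (z - w)) • B l)
        (0 : (ι → ℂ) →L[ℂ] ι → ℂ) w := by
      intro l
      have h2 := (hg l).sub ((dotCLM (g l)).hasFDerivAt.comp w ((hasFDerivAt_id w).sub_const w))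
      refine (h2.smul_const (B l)).congr_fderiv (ContinuousLinearMap.ext fun v => ?_)
      simp
    refine ((hasFDerivAt_id w).add (HasFDerivAt.fun_sum fun l _ => h1 l)).congr_fderiv
      (ContinuousLinearMap.ext fun v => ?_)
    simp
  have hc : ContDiffAt ℂ ω H w := hHan.contDiffAt
  have hstrict := hc.hasStrictFDerivAt' hHd (by simp)
  have hinv := hc.to_localInverse hHd (by simp)
  have hinvd := hstrict.to_localInverse
  have hright := hstrict.eventually_right_inverse
  have hinvw := hstrict.localInverse_apply_image
  change ContDiffAt ℂ ω (hstrict.localInverse _ _ _) _ at hinv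
  set L := hstrict.localInverse _ _ _
  rw [hHw] at hinv hinvd hright hinvw
  have hline : HasDerivAt (fun s : ℂ => w + s • a) a 0 := by
    simpa using! ((hasDerivAt_id (0 : ℂ)).smul_const a).const_add w
  have hline0 : w + (0 : ℂ) • a = w := by simp
  have hright' : ∀ᶠ s : ℂ in 𝓝 0, H (L (w + s • a)) = w + s • a := by
    have h2 : Filter.Tendsto (fun s : ℂ => w + s • a) (𝓝 0) (𝓝 w) := by
      simpa only [hline0] using hline.continuousAt.tendsto
    exact h2.eventually hright
  refine ⟨fun s => L (w + s • a), ?_, ?_, ?_, ?_, ?_⟩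
  · refine AnalyticAt.comp_of_eq (g := L) hinv.analyticAt ?_ hline0
    exact analyticAt_const.add (analyticAt_id.smul analyticAt_const)
  · simp [hinvw]
  · have := hinvd.hasFDerivAt
    rw [← hline0] at this
    exact (this.comp_hasDerivAt (0 : ℂ) hline)
  · intro τ hτ
    filter_upwards [hright'] with s hs
    have := congrFun hs τ
    simpa [H, hτ] using this
  · intro l
    filter_upwards [hright'] with s hs
    have h1 := congrArg (dotCLM (g l)) hs
    have h2 : ∀ m, dotCLM (g l) (B m) = if l = m then 1 else 0 := fun m => by
      rw [dotCLM_apply, hB]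
    have h3 : dotCLM (g l) a = 0 := by rw [dotCLM_apply, ha]
    simp only [H, map_add, map_sum, map_smul, h2, h3, map_sub, smul_eq_mul, mul_ite, mul_one,
      mul_zero, Finset.sum_ite_eq, Finset.mem_univ, if_true] at h1
    linear_combination h1

section

variable {j : ℂ → ℂ} {ι : Type*} [Fintype ι]

theorem hasDerivAt_aeval_jetVal_comp (hj : DifferentiableOn ℂ j HH) (K : Subfield ℂ)
    {u : ℂ → ι → ℂ} {s : ℂ} (hs : ∀ i, u s i ∈ HH) (hu : DifferentiableAt ℂ u s)
    (p : MvPolynomial (ι × ℕ) K) :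
    HasDerivAt (fun t => aeval (jetVal j (u t)) p)
      (∑ i, aeval (jetVal j (u s)) (jetDeriv K i p) * deriv u s i) s := by
  have := (hasStrictFDerivAt_aeval_jetVal hj K hs p).hasFDerivAt.comp_hasDerivAt s hu.hasDerivAt
  rwa [dotCLM_apply] at this

theorem analyticAt_aeval_jetVal_comp (hj : DifferentiableOn ℂ j HH) (K : Subfield ℂ)
    {u : ℂ → ι → ℂ} {s : ℂ} (hs : ∀ i, u s i ∈ HH) (hu : AnalyticAt ℂ u s)
    (p : MvPolynomial (ι × ℕ) K) :
    AnalyticAt ℂ (fun t => aeval (jetVal j (u t)) p) s :=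
  (analyticAt_aeval_jetVal hj K hs p).comp hu

theorem eventually_forall_mem_HH {u : ℂ → ι → ℂ} {s : ℂ} (hs : ∀ i, u s i ∈ HH)
    (hu : ContinuousAt u s) : ∀ᶠ t in 𝓝 s, ∀ i, u t i ∈ HH :=
  Filter.eventually_all.2 fun i =>
    ((continuous_apply i).continuousAt.comp hu).eventually_mem (isOpen_HH.mem_nhds (hs i))

theorem aeval_jetVal_eventually_eq_zero (hj : DifferentiableOn ℂ j HH) {K : Subfield ℂ}
    {w : ι → ℂ} (hw : ∀ i, w i ∈ HH) {u : ℂ → ι → ℂ} (hu : AnalyticAt ℂ u 0) (hu0 : u 0 = w)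
    {n : ℕ} {F : Fin n → MvPolynomial (ι × ℕ) K}
    (hF : ∀ l, ∀ᶠ s in 𝓝 0, aeval (jetVal j (u s)) (F l) = 0)
    (hI : ∀ f : MvPolynomial (ι × ℕ) K, aeval (jetVal j w) f = 0 →
      ∃ m, aeval (jetVal j w) m ≠ 0 ∧ ∃ r : Fin n → MvPolynomial (ι × ℕ) K, ∀ i,
        aeval (jetVal j w) (m * jetDeriv K i f) =
          aeval (jetVal j w) (∑ l, r l * jetDeriv K i (F l)))
    {f : MvPolynomial (ι × ℕ) K} (hf : aeval (jetVal j w) f = 0) :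
    ∀ᶠ s in 𝓝 0, aeval (jetVal j (u s)) f = 0 := by
  subst hu0
  have han := analyticAt_aeval_jetVal_comp hj K hw hu
  have hnear : ∀ᶠ s in 𝓝 0, (∀ i, u s i ∈ HH) ∧ DifferentiableAt ℂ u s :=
    (eventually_forall_mem_HH hw hu.continuousAt).and
      (hu.eventually_analyticAt.mono fun s hs => hs.differentiableAt)
  have hFd : ∀ l, ∀ᶠ s in 𝓝 0,
      ∑ i, aeval (jetVal j (u s)) (jetDeriv K i (F l)) * deriv u s i = 0 := by
    intro l
    filter_upwards [hnear, (hF l).eventually_nhds] with s hs hFs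
    refine (hasDerivAt_aeval_jetVal_comp hj K hs.1 hs.2 (F l)).unique ?_
    exact (hasDerivAt_const s (0 : ℂ)).congr_of_eventuallyEq hFs
  rw [← analyticOrderAt_eq_top, ENat.eq_top_iff_forall_ge]
  intro N
  induction N generalizing f with
  | zero => simp
  | succ N ih =>
    obtain ⟨m, hm, r, hr⟩ := hI f hf
    let p : ι → MvPolynomial (ι × ℕ) K := fun i =>
      m * jetDeriv K i f - ∑ l, r l * jetDeriv K i (F l)
    have hp : ∀ i, aeval (jetVal j (u 0)) (p i) = 0 := fun i => by
      rw [map_sub, hr, sub_self]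
    have hud : ∀ i, AnalyticAt ℂ (fun s => deriv u s i) 0 := fun i =>
      ((ContinuousLinearMap.proj (R := ℂ) (φ := fun _ : ι => ℂ) i).analyticAt _).comp hu.deriv
    have key : (fun s => aeval (jetVal j (u s)) m * deriv (fun t => aeval (jetVal j (u t)) f) s)
        =ᶠ[𝓝 0] fun s => ∑ i, aeval (jetVal j (u s)) (p i) * deriv u s i := by
      filter_upwards [hnear, Filter.eventually_all.2 hFd] with s hs hFs
      rw [(hasDerivAt_aeval_jetVal_comp hj K hs.1 hs.2 f).deriv]
      simp only [p, map_sub, map_mul, map_sum, sub_mul, Finset.sum_sub_distrib, Finset.mul_sum,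
        Finset.sum_mul, mul_assoc]
      rw [Finset.sum_comm (γ := ι)]
      simp only [← Finset.mul_sum, hFs]
      simp
    have hsum : (N : ℕ∞) ≤ analyticOrderAt
        (fun s => ∑ i, aeval (jetVal j (u s)) (p i) * deriv u s i) 0 := by
      have hterm : ∀ i, ∃ g : ℂ → ℂ, AnalyticAt ℂ g 0 ∧
          ∀ᶠ z in 𝓝 0, aeval (jetVal j (u z)) (p i) = (z - 0) ^ N • g z := fun i =>
        (natCast_le_analyticOrderAt (han _)).1 (ih (hp i))
      choose g hg hpg using hterm
      refine (natCast_le_analyticOrderAt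
        (Finset.analyticAt_fun_sum _ fun i _ => (han (p i)).fun_mul (hud i))).2
        ⟨fun s => ∑ i, g i s * deriv u s i,
        Finset.analyticAt_fun_sum _ fun i _ => (hg i).fun_mul (hud i), ?_⟩
      filter_upwards [Filter.eventually_all.2 hpg] with s hs
      simp only [hs, smul_eq_mul, Finset.mul_sum, mul_assoc]
    rw [← analyticOrderAt_congr key] at hsum
    have hmul := analyticOrderAt_mul (han m) (han f).deriv
    rw [(han m).analyticOrderAt_eq_zero.2 hm, zero_add] at hmul
    have hd := (han f).analyticOrderAt_deriv_add_one
    simp only [hf, sub_zero] at hd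
    rw [← hd, Nat.cast_succ]
    gcongr
    exact hsum.trans_eq hmul

end

theorem aeval_jetVal_rename (j : ℂ → ℂ) {ι : Type*} {K : Subfield ℂ} (z : ι → ℂ)
    (f : MvPolynomial (Fin 4 × ι) K) :
    aeval (jetVal j z) (rename (fun p : Fin 4 × ι => (p.2, (p.1 : ℕ))) f) =
      aeval (jTuple j z) f := by
  rw [aeval_rename]
  congr 2
  ext p
  exact jetVal_comp j z p

/-- The vector field defined by a `j`-derivation integrates to an analytic curve along which all
algebraic relations over the field of constants persist. -/
theorem exists_integral_curve {j D : ℂ → ℂ} (hj : DifferentiableOn ℂ j HH) (hD : IsJDeriv j D)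
    {ι : Type*} [Fintype ι] {w : ι → ℂ} (hw : ∀ i, w i ∈ HH) {τ : ι} (hτ : D (w τ) ≠ 0) :
    ∃ u : ℂ → ι → ℂ, AnalyticAt ℂ u 0 ∧ u 0 = w ∧ HasDerivAt u (fun i => D (w i)) 0 ∧
      (∀ᶠ s in 𝓝 0, u s τ = w τ + s * D (w τ)) ∧
      ∀ f : MvPolynomial (Fin 4 × ι) hD.constants, aeval (jTuple j w) f = 0 →
        ∀ᶠ s in 𝓝 0, aeval (jTuple j (u s)) f = 0 := by
  obtain ⟨n, F, B, hFI, hB, hBτ, hI⟩ := exists_biorthogonal_polynomials (x := jetVal j w)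
    (I := {f : MvPolynomial (ι × ℕ) hD.constants | aeval (jetVal j w) f = 0})
    (δ := fun i f => jetDeriv hD.constants i f) (a := fun i => D (w i))
    (fun f hf => by rw [← hD.apply_aeval_jetVal hw, hf, hD.map_zero]) hτ
  obtain ⟨u, hu, hu0, hud, huτ, hF⟩ := exists_analytic_curve
    (Φ := fun l y => aeval (jetVal j y) (F l)) (w := w) (a := fun i => D (w i)) (B := B)
    (g := fun l i => aeval (jetVal j w) (jetDeriv hD.constants i (F l)))
    (fun l => analyticAt_aeval_jetVal hj _ hw (F l))
    (fun l => (hasStrictFDerivAt_aeval_jetVal hj _ hw (F l)).hasFDerivAt) hFI hB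
    (fun l => by
      simp only [mul_comm _ (D _)]
      rw [← hD.apply_aeval_jetVal hw, show aeval (jetVal j w) (F l) = 0 from hFI l, hD.map_zero])
  refine ⟨u, hu, hu0, hud, huτ τ hBτ, fun f hf => ?_⟩
  simp only [← aeval_jetVal_rename] at hf ⊢
  exact aeval_jetVal_eventually_eq_zero hj hw hu hu0 hF hI hf

theorem eventually_isAlgebraic_of_relations {K : Subfield ℂ} {κ : Type*} {x : ℂ → κ → ℂ}
    (hx : ∀ f : MvPolynomial κ K, ContinuousAt (fun s => aeval (x s) f) 0)
    (hrel : ∀ f : MvPolynomial κ K, aeval (x 0) f = 0 → ∀ᶠ s in 𝓝 0, aeval (x s) f = 0)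
    {T : Set κ} {e : κ} (he : IsAlgebraic (Algebra.adjoin K (x 0 '' T)) (x 0 e)) :
    ∃ S : Finset ℂ, ∀ᶠ s in 𝓝 0, ∀ A : Subalgebra (⊥ : Subfield ℂ) ℂ, (S : Set ℂ) ⊆ A →
      (∀ b ∈ T, x s b ∈ A) → IsAlgebraic A (x s e) := by
  classical
  obtain ⟨P, hP0, hP⟩ := he
  have hlift : ∀ n, ∃ q : MvPolynomial T K,
      aeval (x 0) (rename Subtype.val q) = (P.coeff n : ℂ) := by
    intro n
    generalize P.coeff n = c
    obtain ⟨y, h⟩ := c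
    rw [Set.image_eq_range, Algebra.adjoin_range_eq_range_aeval] at h
    obtain ⟨q, hq⟩ := h
    exact ⟨q, by rw [aeval_rename]; exact hq⟩
  choose q hq using hlift
  have h0 := hrel (∑ n ∈ Finset.range (P.natDegree + 1), rename Subtype.val (q n) * X e ^ n) (by
    rw [Polynomial.aeval_eq_sum_range] at hP
    simp only [map_sum, map_mul, hq, map_pow, aeval_X]
    exact hP)
  have hlead : ∀ᶠ s in 𝓝 0, aeval (x s) (rename Subtype.val (q P.natDegree)) ≠ 0 := by
    refine (hx _).eventually_ne ?_
    rw [hq]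
    simpa using hP0
  refine ⟨(Finset.range (P.natDegree + 1)).biUnion fun n =>
    (q n).support.image fun m => ((coeff m (q n) : K) : ℂ), ?_⟩
  filter_upwards [h0, hlead] with s hs hls A hSA hTA
  have hmem : ∀ n ∈ Finset.range (P.natDegree + 1),
      aeval (x s) (rename Subtype.val (q n)) ∈ A := by
    intro n hn
    rw [aeval_rename]
    refine eval₂_mem (fun m hm => hSA ?_) fun b => hTA b.1 b.2
    exact Finset.mem_biUnion.2 ⟨n, hn, Finset.mem_image_of_mem _ hm⟩
  refine ⟨∑ n ∈ (Finset.range (P.natDegree + 1)).attach,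
    Polynomial.monomial n.1 (⟨_, hmem n n.2⟩ : A),
    fun h => hls ?_, ?_⟩
  · have h1 := congrArg (fun R => ((Polynomial.coeff R P.natDegree : A) : ℂ)) h
    simp only [Polynomial.finsetSum_coeff, Polynomial.coeff_monomial, Polynomial.coeff_zero] at h1
    rw [Finset.sum_eq_single (⟨P.natDegree, by simp⟩ : {n // n ∈ Finset.range (P.natDegree + 1)})
      (fun b _ hb => if_neg fun h => hb (Subtype.ext h)) (by simp)] at h1
    simpa using h1
  · simp only [map_sum, Polynomial.aeval_monomial]
    rw [map_sum, ← Finset.sum_attach] at hs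
    simpa using! hs

/-- Over the algebra generated by a maximal algebraically independent subfamily and finitely many
constants, a family of functions satisfying the same relations as its value at the origin is
pointwise algebraic. -/
theorem eventually_forall_isAlgebraic {K : Subfield ℂ} {κ : Type*} [Finite κ] {x : ℂ → κ → ℂ}
    (hx : ∀ f : MvPolynomial κ K, ContinuousAt (fun s => aeval (x s) f) 0)
    (hrel : ∀ f : MvPolynomial κ K, aeval (x 0) f = 0 → ∀ᶠ s in 𝓝 0, aeval (x s) f = 0)
    {T : Set κ} (hT : AlgebraicIndepOn K (x 0) T)
    (hmax : ∀ e ∉ T, ¬ AlgebraicIndepOn K (x 0) (insert e T)) :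
    ∃ S : Finset ℂ, ∀ᶠ s in 𝓝 0, ∀ A : Subalgebra (⊥ : Subfield ℂ) ℂ, (S : Set ℂ) ⊆ A →
      (∀ b ∈ T, x s b ∈ A) → ∀ e, IsAlgebraic A (x s e) := by
  classical
  have := Fintype.ofFinite κ
  have halg : ∀ e, IsAlgebraic (Algebra.adjoin K (x 0 '' T)) (x 0 e) := by
    intro e
    by_cases he : e ∈ T
    · exact isAlgebraic_algebraMap
        (⟨x 0 e, Algebra.subset_adjoin ⟨e, he, rfl⟩⟩ : Algebra.adjoin K (x 0 '' T))
    · by_contra h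
      exact hmax e he ((AlgebraicIndepOn.insert_iff he).2 ⟨hT, h⟩)
  choose S hS using fun e => eventually_isAlgebraic_of_relations hx hrel (halg e)
  refine ⟨Finset.univ.biUnion S, ?_⟩
  filter_upwards [Filter.eventually_all.2 hS] with s hs A hSA hTA e
  refine hs e A (fun y hy => hSA ?_) hTA
  exact Finset.mem_biUnion.2 ⟨e, Finset.mem_univ e, hy⟩

theorem countable_zeros_of_analyticOnNhd_ball {φ : ℂ → ℂ} {r : ℝ} (hr : 0 < r)
    (hφ : AnalyticOnNhd ℂ φ (Metric.ball 0 r)) (h : ¬ ∀ᶠ s in 𝓝 0, φ s = 0) :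
    ({s | φ s ≠ 0}ᶜ ∩ Metric.ball 0 r).Countable := by
  refine (HereditarilyLindelofSpace.isLindelof _).countable_of_isDiscrete
    (isDiscrete_of_codiscreteWithin ?_)
  rw [compl_compl]
  refine (hφ.eqOn_zero_or_eventually_ne_zero_of_preconnected
    (convex_ball (0 : ℂ) r).isPreconnected).resolve_left fun h0 => h ?_
  filter_upwards [Metric.ball_mem_nhds (0 : ℂ) hr] with s hs using h0 hs

theorem exists_forall_ne_zero_of_countable {α : Type*} [Countable α] {φ : α → ℂ → ℂ} {r : ℝ}
    (hr : 0 < r) (hφ : ∀ a, AnalyticOnNhd ℂ (φ a) (Metric.ball 0 r))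
    (h : ∀ a, ¬ ∀ᶠ s in 𝓝 0, φ a s = 0) : ∃ s ∈ Metric.ball (0 : ℂ) r, ∀ a, φ a s ≠ 0 := by
  have hc := Set.countable_iUnion fun a => countable_zeros_of_analyticOnNhd_ball hr (hφ a) (h a)
  obtain ⟨s, hs, hsc⟩ := (hc.dense_compl ℂ).exists_mem_open Metric.isOpen_ball
    ⟨0, Metric.mem_ball_self hr⟩
  refine ⟨s, hsc, fun a h0 => hs (Set.mem_iUnion.2 ⟨a, ?_, hsc⟩)⟩
  simpa using h0

theorem countable_SigmaSet : SigmaSet.Countable := by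
  refine (Algebraic.countable ℚ ℂ).mono fun c hc => ?_
  refine isAlgebraic_iff_isIntegral.2 ?_
  by_contra hn
  have := hc.2
  rw [minpoly.eq_zero hn] at this
  simp at this

/-- The numerator of `y - g • x`. -/
def moebDefect (g : Matrix (Fin 2) (Fin 2) ℚ) (x y : ℂ) : ℂ :=
  y * (g 1 0 * x + g 1 1) - (g 0 0 * x + g 0 1)

theorem analyticAt_moebDefect {x y : ℂ → ℂ} {s : ℂ} (hx : AnalyticAt ℂ x s)
    (hy : AnalyticAt ℂ y s) (g : Matrix (Fin 2) (Fin 2) ℚ) :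
    AnalyticAt ℂ (fun t => moebDefect g (x t) (y t)) s :=
  (hy.mul ((analyticAt_const.mul hx).add analyticAt_const)).sub
    ((analyticAt_const.mul hx).add analyticAt_const)

theorem not_eventually_moebDefect_eq_zero {g : Matrix (Fin 2) (Fin 2) ℚ} (hg : 0 < g.det)
    {x y : ℂ → ℂ} (hx0 : x 0 ∈ HH) (h : ¬ GRel (x 0) (y 0)) :
    ¬ ∀ᶠ s in 𝓝 0, moebDefect g (x s) (y s) = 0 := fun h0 =>
  h ⟨g, hg, (moeb_qmat_eq_iff hg hx0).2 h0.self_of_nhds⟩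

theorem not_eventually_moebDefect_eq_zero_of_deriv_ne {g : Matrix (Fin 2) (Fin 2) ℚ}
    (hg : 0 < g.det) {x y : ℂ → ℂ} {x' y' : ℂ} (hx : HasDerivAt x x' 0) (hy : HasDerivAt y y' 0)
    (hx0 : x 0 ∈ HH) (hxS : x 0 ∉ SigmaSet) (hxy : x 0 = y 0) (h : x' ≠ y') :
    ¬ ∀ᶠ s in 𝓝 0, moebDefect g (x s) (y s) = 0 := fun h0 => by
  obtain ⟨h1, h2, h3⟩ := scalar_of_moeb_qmat_self hg hx0 hxS
    ((moeb_qmat_eq_iff hg hx0).2 (by simpa only [← hxy] using! h0.self_of_nhds))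
  have hg0 : (g 0 0 : ℂ) ≠ 0 := by
    rintro h4
    rw [Matrix.det_fin_two, h1, h3, Rat.cast_eq_zero.1 h4] at hg
    simp at hg
  have heq : x =ᶠ[𝓝 0] y := by
    filter_upwards [h0] with s hs
    simp only [moebDefect, h1, h2, h3, Rat.cast_zero, zero_mul, zero_add, add_zero] at hs
    refine mul_left_cancel₀ hg0 ?_
    linear_combination -hs
  exact h (hx.unique (hy.congr_of_eventuallyEq heq))

theorem exists_generic_points {ι : Type*} [Fintype ι] {w a : ι → ℂ} (hw : ∀ i, w i ∈ HH)
    (hpair : ∀ i k, GRel (w i) (w k) → i = k) (hS : ∀ i, ∀ c ∈ SigmaSet, ¬ GRel (w i) c)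
    {u : ℂ → ι → ℂ} (hu : AnalyticAt ℂ u 0) (hu0 : u 0 = w) (hud : HasDerivAt u a 0)
    (ha : ∀ i, a i ≠ 0) {P : ℂ → Prop} (hP : ∀ᶠ s in 𝓝 0, P s) (n : ℕ) :
    ∃ μ : ℂ, ∃ z : Fin n × ι → ℂ, (∀ k i, z (k, i) = u ((k : ℂ) * μ) i) ∧
      (∀ k : Fin n, P ((k : ℂ) * μ)) ∧ (∀ p, z p ∈ HH) ∧ (∀ p q, GRel (z p) (z q) → p = q) ∧
      ∀ p, ∀ c ∈ SigmaSet, ¬ GRel (z p) c := by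
  obtain ⟨R, hR, hball⟩ := Metric.eventually_nhds_iff_ball.1
    (hu.eventually_analyticAt.and ((eventually_forall_mem_HH (hu0 ▸ hw) hu.continuousAt).and hP))
  have hscale : ∀ k : Fin n, ∀ μ ∈ Metric.ball (0 : ℂ) (R / (n + 1)),
      (k : ℂ) * μ ∈ Metric.ball (0 : ℂ) R := by
    intro k μ hμ
    rw [mem_ball_zero_iff, lt_div_iff₀ (by positivity)] at hμ
    rw [mem_ball_zero_iff, norm_mul, Complex.norm_natCast]
    have hk : (k : ℝ) ≤ n + 1 := by exact_mod_cast k.2.le.trans n.le_succ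
    nlinarith [norm_nonneg μ]
  let x : Fin n × ι → ℂ → ℂ := fun p μ => u (p.1 * μ) p.2
  have hx0 : ∀ p, x p 0 = w p.2 := fun p => by simp [x, hu0]
  have hxan : ∀ p, AnalyticOnNhd ℂ (x p) (Metric.ball 0 (R / (n + 1))) := fun p μ hμ =>
    ((ContinuousLinearMap.proj (R := ℂ) (φ := fun _ : ι => ℂ) p.2).analyticAt _).comp
      ((hball _ (hscale p.1 μ hμ)).1.comp_of_eq (analyticAt_const.mul analyticAt_id) rfl)
  have hxd : ∀ p, HasDerivAt (x p) (p.1 * a p.2) 0 := fun p => by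
    have h1 : HasDerivAt (fun s => u s p.2) (a p.2) ((p.1 : ℂ) * 0) := by
      rw [mul_zero]; exact hasDerivAt_pi.1 hud p.2
    have h2 : HasDerivAt (fun μ : ℂ => (p.1 : ℂ) * μ) (p.1 : ℂ) 0 := by
      simpa using (hasDerivAt_id (0 : ℂ)).const_mul (p.1 : ℂ)
    simpa [mul_comm] using! h1.comp (0 : ℂ) h2
  have := countable_SigmaSet.to_subtype
  have : Countable (Matrix (Fin 2) (Fin 2) ℚ) :=
    inferInstanceAs (Countable (Fin 2 → Fin 2 → ℚ))
  obtain ⟨μ, hμ, hne⟩ := exists_forall_ne_zero_of_countable (r := R / (n + 1)) (by positivity)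
    (α := {g : Matrix (Fin 2) (Fin 2) ℚ // 0 < g.det} ×
      ({p : (Fin n × ι) × (Fin n × ι) // p.1 ≠ p.2} ⊕ (Fin n × ι) × SigmaSet))
    (φ := fun c => c.2.elim (fun p μ => moebDefect c.1 (x p.1.1 μ) (x p.1.2 μ))
      fun p μ => moebDefect c.1 (x p.1 μ) p.2)
    (by
      rintro ⟨g, p | p⟩ μ hμ
      · exact analyticAt_moebDefect (hxan _ μ hμ) (hxan _ μ hμ) g
      · exact analyticAt_moebDefect (hxan _ μ hμ) analyticAt_const g)
    (by
      rintro ⟨⟨g, hg⟩, ⟨⟨p, q⟩, hpq⟩ | ⟨p, c, hc⟩⟩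
      · by_cases hi : p.2 = q.2
        · refine not_eventually_moebDefect_eq_zero_of_deriv_ne hg (hxd p) (hxd q) ?_ ?_ ?_ ?_
          · rw [hx0]; exact hw _
          · rw [hx0]; exact fun h => hS _ _ h (GRel.refl _)
          · rw [hx0, hx0, hi]
          · rw [hi]
            intro h
            refine hpq (Prod.ext (Fin.ext ?_) hi)
            exact_mod_cast mul_right_cancel₀ (ha _) h
        · refine not_eventually_moebDefect_eq_zero hg ?_ ?_
          · rw [hx0]; exact hw _
          · rw [hx0, hx0]; exact fun h => hi (hpair _ _ h)
      · refine not_eventually_moebDefect_eq_zero (y := fun _ => c) hg ?_ ?_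
        · rw [hx0]; exact hw _
        · rw [hx0]; exact hS _ c hc)
  have hH : ∀ p, x p μ ∈ HH := fun p => (hball _ (hscale p.1 μ hμ)).2.1 p.2
  refine ⟨μ, fun p => x p μ, fun _ _ => rfl, fun k => (hball _ (hscale k μ hμ)).2.2, hH, ?_, ?_⟩
  · rintro p q ⟨g, hg, hgpq⟩
    by_contra hpq
    exact hne (⟨g, hg⟩, Sum.inl ⟨(p, q), hpq⟩) ((moeb_qmat_eq_iff hg (hH p)).1 hgpq)
  · rintro p c hc ⟨g, hg, hgpc⟩
    exact hne (⟨g, hg⟩, Sum.inr (p, ⟨c, hc⟩)) ((moeb_qmat_eq_iff hg (hH p)).1 hgpc)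

theorem exists_maximal_algebraicIndepOn {K : Subfield ℂ} {κ : Type*} [Finite κ] {v : κ → ℂ} {e : κ}
    (he : Transcendental K (v e)) :
    ∃ T : Finset κ, e ∈ T ∧ AlgebraicIndepOn K v (T : Set κ) ∧
      ∀ b ∉ (T : Set κ), ¬ AlgebraicIndepOn K v (insert b (T : Set κ)) := by
  classical
  have hfin : {T : Finset κ | AlgebraicIndepOn K v (T : Set κ)}.Finite := Set.toFinite _
  have h0 : AlgebraicIndepOn K v (({e} : Finset κ) : Set κ) := by
    rw [Finset.coe_singleton]
    exact algebraicIndependent_unique_type_iff.2 he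
  obtain ⟨T, heT, hT⟩ := hfin.exists_le_maximal h0
  refine ⟨T, heT (by simp), hT.1, fun b hb h => hb ?_⟩
  rw [← Finset.coe_insert] at h
  exact hT.2 h (Finset.subset_insert b T) (Finset.mem_insert_self b T)

theorem exists_algebraicIndepOn_constants {j D : ℂ → ℂ} (hj : DifferentiableOn ℂ j HH)
    (hM : MSCD j) (hD : IsJDeriv j D) {ι : Type*} [Fintype ι] [Nonempty ι] {w : ι → ℂ}
    (hw : ∀ i, w i ∈ HH)
    (hpair : ∀ i k, GRel (w i) (w k) → i = k) (hS : ∀ i, ∀ c ∈ SigmaSet, ¬ GRel (w i) c)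
    (hne : ∀ i, D (w i) ≠ 0) :
    ∃ T : Finset (Fin 4 × ι), AlgebraicIndepOn hD.constants (jTuple j w) (T : Set (Fin 4 × ι)) ∧
      3 * Fintype.card ι + 1 ≤ T.card := by
  classical
  obtain ⟨τ⟩ := ‹Nonempty ι›
  obtain ⟨u, hu, hu0, hud, huτ, hrel⟩ := exists_integral_curve hj hD hw (hne τ)
  obtain ⟨T, hτT, hT, hmax⟩ := exists_maximal_algebraicIndepOn (K := hD.constants)
    (v := jTuple j w) (e := (0, τ)) fun h => hne τ (hD.eq_zero_of_isAlgebraic h)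
  refine ⟨T, hT, ?_⟩
  by_contra hcard
  obtain ⟨S, hSalg⟩ := eventually_forall_isAlgebraic (K := hD.constants)
    (x := fun s => jTuple j (u s)) (T := (T : Set (Fin 4 × ι)))
    (fun f => by
      simp only [← aeval_jetVal_rename]
      exact (analyticAt_aeval_jetVal_comp hj _ (hu0 ▸ hw) hu _).continuousAt)
    (by simpa only [hu0] using hrel) (by simpa only [hu0] using hT) (by simpa only [hu0] using hmax)
  obtain ⟨μ, z, hz, hP, hzH, hzpair, hzS⟩ := exists_generic_points hw hpair hS hu hu0 hud hne
    (hSalg.and huτ) (S.card + 3)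
  obtain ⟨t, htcard, ht⟩ := exists_card_eq_trdegF ⊥ (jTuple j z)
  have hzk : ∀ m k i, jTuple j z (m, (k, i)) = jTuple j (u ((k : ℂ) * μ)) (m, i) := by
    intro m k i
    have h := congrFun (jTuple_comp j z (fun i => (k, i))) (m, i)
    rw [show z ∘ (fun i => (k, i)) = u ((k : ℂ) * μ) from funext fun i => hz k i] at h
    exact h.symm
  let Y : Finset ℂ := S ∪ {w τ, μ * D (w τ)} ∪
    ((Finset.univ : Finset (Fin (S.card + 3))) ×ˢ T.erase (0, τ)).image
      fun q => jTuple j (u ((q.1 : ℂ) * μ)) q.2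
  let A := Algebra.adjoin (⊥ : Subfield ℂ) (Y : Set ℂ)
  have hY : ∀ y ∈ Y, y ∈ A := fun y hy => Algebra.subset_adjoin hy
  have htY := card_le_card_of_algebraicIndepOn ht Y (by
    rintro ⟨m, k, i⟩ -
    rw [hzk]
    refine (hP k).1 A (fun y hy => hY y ?_) (fun b hb => ?_) (m, i)
    · exact Finset.mem_union_left _ (Finset.mem_union_left _ hy)
    · by_cases hbτ : b = (0, τ)
      · subst hbτ
        rw [jTuple_zero, (hP k).2, mul_assoc]
        exact add_mem (hY _ (by simp [Y])) (mul_mem (natCast_mem A _) (hY _ (by simp [Y])))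
      · refine hY _ (Finset.mem_union_right _ (Finset.mem_image.2 ⟨(k, b), ?_, rfl⟩))
        simpa [hbτ] using hb)
  have hYcard : Y.card ≤ S.card + 2 + (S.card + 3) * (T.card - 1) := by
    refine (Finset.card_union_le _ _).trans (add_le_add ?_ ?_)
    · exact (Finset.card_union_le _ _).trans (add_le_add le_rfl Finset.card_le_two)
    · refine Finset.card_image_le.trans ?_
      rw [Finset.card_product, Finset.card_univ, Fintype.card_fin, Finset.card_erase_of_mem hτT]
  have hlow := hM.card_le hzH hzpair hzS
  rw [Fintype.card_prod, Fintype.card_fin, ← htcard] at hlow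
  have hTpos : 0 < T.card := Finset.card_pos.2 ⟨_, hτT⟩
  obtain ⟨d, hd⟩ := Nat.exists_eq_succ_of_ne_zero hTpos.ne'
  rw [hd, Nat.succ_sub_one] at hYcard
  have hdc : d + 1 ≤ 3 * Fintype.card ι := by omega
  have := Nat.mul_le_mul_left (S.card + 3) hdc
  nlinarith

end

theorem exists_algebraicIndepOn_image_subtype {K : Subfield ℂ} {j : ℂ → ℂ} {ι : Type*}
    {w : ι → ℂ} {s : Finset ι} {T : Finset (Fin 4 × s)}
    (hT : AlgebraicIndepOn K (jTuple j (fun i : s => w i)) (T : Set (Fin 4 × s))) :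
    ∃ T' : Finset (Fin 4 × ι), (∀ p ∈ T', p.2 ∈ s) ∧
      AlgebraicIndepOn K (jTuple j w) (T' : Set (Fin 4 × ι)) ∧ T'.card = T.card := by
  classical
  change AlgebraicIndepOn K (jTuple j (w ∘ ((↑) : s → ι))) (T : Set (Fin 4 × s)) at hT
  rw [jTuple_comp] at hT
  refine ⟨_, ?_, algebraicIndepOn_image_of_comp hT⟩
  intro p hp
  obtain ⟨q, -, rfl⟩ := Finset.mem_image.1 hp
  exact q.2.2

theorem exists_algebraicIndepOn_jTuple {j : ℂ → ℂ} (hj : DifferentiableOn ℂ j HH)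
    (hM : MSCD j) {ι : Type*} {w : ι → ℂ} (hw : ∀ i, w i ∈ HH)
    (hpair : ∀ i k, GRel (w i) (w k) → i = k) (hS : ∀ i, ∀ c ∈ SigmaSet, ¬ GRel (w i) c)
    (s : Finset ι) :
    ∃ T : Finset (Fin 4 × ι), (∀ p ∈ T, p.2 ∈ s) ∧
      AlgebraicIndepOn (⊥ : Subfield ℂ) (jTuple j w) (T : Set (Fin 4 × ι)) ∧
      3 * s.card + Module.finrank ℂ (jTangent j (fun i : s => w i)) ≤ T.card := by
  classical
  induction s using Finset.strongInduction with
  | H s ih =>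
  have hpair' : ∀ (r : Finset ι) (i k : r), GRel (w i) (w k) → i = k :=
    fun r i k h => Subtype.ext (hpair _ _ h)
  by_cases hX : ∀ D, IsJDeriv j D → ∀ i ∈ s, D (w i) = 0
  · have h0 : jTangent j (fun i : s => w i) = ⊥ := by
      rw [eq_bot_iff]
      rintro _ ⟨D, hD, rfl⟩
      rw [Submodule.mem_bot]
      ext i
      exact hX D hD i i.2
    rw [h0, finrank_bot, add_zero]
    have h1 := hM.card_le (fun i : s => hw i) (hpair' s) (fun i => hS i)
    obtain ⟨T, hTc, hT⟩ := exists_card_eq_trdegF ⊥ (jTuple j (fun i : s => w i))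
    obtain ⟨T', hs, hT', hc⟩ := exists_algebraicIndepOn_image_subtype hT
    refine ⟨T', hs, hT', ?_⟩
    rw [hc, hTc]
    simpa using h1
  · let V : (ℂ → ℂ) → Finset ι := fun D => s.filter fun i => D (w i) = 0
    let P : Finset (Finset ι) := s.powerset.filter fun c => c ≠ s ∧ ∃ D, IsJDeriv j D ∧ V D = c
    have hP : P.Nonempty := by
      push Not at hX
      obtain ⟨D, hD, i, hi, hDi⟩ := hX
      refine ⟨V D, Finset.mem_filter.2 ⟨Finset.mem_powerset.2 (Finset.filter_subset _ _),
        fun h => hDi ?_, D, hD, rfl⟩⟩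
      rw [← h] at hi
      exact (Finset.mem_filter.1 hi).2
    obtain ⟨c, hcP, hcmax⟩ := P.exists_max_image Finset.card hP
    obtain ⟨hcs, hne, D, hD, rfl⟩ := Finset.mem_filter.1 hcP
    rw [Finset.mem_powerset] at hcs
    obtain ⟨Tc, hTcs, hTc, hTcc⟩ := ih _ (Finset.ssubset_iff_subset_ne.2 ⟨hcs, hne⟩)
    have hDc : ∀ i ∈ V D, D (w i) = 0 := fun i hi => (Finset.mem_filter.1 hi).2
    have hfin := finrank_jTangent_le_add_one hD hcs hDc fun E hE hEc => by
      obtain ⟨l, hls, hlc⟩ := Finset.exists_of_ssubset (Finset.ssubset_iff_subset_ne.2 ⟨hcs, hne⟩)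
      have hDl : D (w l) ≠ 0 := fun h => hlc (Finset.mem_filter.2 ⟨hls, h⟩)
      refine ⟨E (w l) / D (w l), fun i hi => ?_⟩
      have hF : IsJDeriv j (E - (E (w l) / D (w l)) • D) :=
        (jDerivations j).sub_mem hE ((jDerivations j).smul_mem _ hD)
      set F := E - (E (w l) / D (w l)) • D with hFdef
      have hsub : insert l (V D) ⊆ V F := by
        intro i hi
        rcases Finset.mem_insert.1 hi with rfl | hi
        · exact Finset.mem_filter.2 ⟨hls, by simp [hFdef, hDl]⟩
        · exact Finset.mem_filter.2 ⟨hcs hi, by simp [hFdef, hEc i hi, hDc i hi]⟩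
      have hVF : V F = s := by
        by_contra hn
        have h1 := hcmax (V F) (Finset.mem_filter.2
          ⟨Finset.mem_powerset.2 (Finset.filter_subset _ _), hn, F, hF, rfl⟩)
        have h2 := Finset.card_le_card hsub
        rw [Finset.card_insert_of_notMem hlc] at h2
        omega
      have := (Finset.mem_filter.1 (hVF ▸ hi : i ∈ V F)).2
      simp only [hFdef, Pi.sub_apply, Pi.smul_apply, smul_eq_mul] at this
      exact (sub_eq_zero.1 this).symm
    have hnonempty : Nonempty (s \ V D : Finset ι) := by
      obtain ⟨l, hls, hlc⟩ := Finset.exists_of_ssubset (Finset.ssubset_iff_subset_ne.2 ⟨hcs, hne⟩)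
      exact ⟨l, Finset.mem_sdiff.2 ⟨hls, hlc⟩⟩
    obtain ⟨T₁, hT₁, hT₁c⟩ := exists_algebraicIndepOn_constants hj hM hD
      (w := fun i : (s \ V D : Finset ι) => w i) (fun i => hw i) (hpair' _) (fun i => hS i)
      (fun i h => (Finset.mem_sdiff.1 i.2).2
        (Finset.mem_filter.2 ⟨(Finset.mem_sdiff.1 i.2).1, h⟩))
    obtain ⟨T', hs', hT', hc'⟩ := exists_algebraicIndepOn_image_subtype hT₁
    obtain ⟨hU, hUc⟩ := algebraicIndepOn_union hTc
      (fun p hp => hD.jTuple_mem_constants (hw _) (hDc _ (hTcs p hp)) p.1) hT'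
    refine ⟨Tc ∪ T', ?_, hU, ?_⟩
    · intro p hp
      rcases Finset.mem_union.1 hp with h | h
      · exact hcs (hTcs p h)
      · exact (Finset.mem_sdiff.1 (hs' p h)).1
    · have := Finset.card_sdiff_add_card_eq_card hcs
      rw [Fintype.card_coe] at hT₁c
      omega

/-- Assuming MSCD: if `t ∈ ℍ^m` is a convenient tuple for `j`, then
for all `z ∈ ℍⁿ`,
`tr.deg_ℚ ℚ(z, t, J(z), J(t)) ≥ 3 dim_G(z, t | Σ) + dim^j(t)` and
`tr.deg_ℚ ℚ(z, t, j(z), j(t)) ≥ dim_G(z, t | Σ) + dim^j(t)`. -/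
theorem trdeg_with_convenient_tuple_of_MSCD
    (j : ℂ → ℂ) (hj : IsModularJ j) (hMSCD : MSCD j)
    (m : ℕ) (t : Fin m → ℂ) (ht : ConvenientTuple j t)
    (n : ℕ) (z : Fin n → ℂ) (hz : ∀ i, z i ∈ HH) :
    3 * dimG (Sum.elim z t) SigmaSet + dimj j (Set.range t) ∅
      ≤ trdegF ⊥ (fun p : Fin 4 × (Fin n ⊕ Fin m) =>
          ![Sum.elim z t, j ∘ Sum.elim z t, deriv j ∘ Sum.elim z t,
            deriv (deriv j) ∘ Sum.elim z t] p.1 p.2) ∧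
    dimG (Sum.elim z t) SigmaSet + dimj j (Set.range t) ∅
      ≤ trdegF ⊥ (Sum.elim (Sum.elim z t) (j ∘ Sum.elim z t)) := by
  classical
  set y := Sum.elim z t
  have hy : ∀ i, y i ∈ HH := Sum.rec hz ht.1
  obtain ⟨f, hpair, hS, hcov⟩ := exists_orbit_representatives hy
  obtain ⟨T, -, hT, hTc⟩ := exists_algebraicIndepOn_jTuple hj.holo hMSCD (w := y ∘ f)
    (fun i => hy _) hpair hS Finset.univ
  have hdim : dimj j (Set.range t) ∅ ≤
      Module.finrank ℂ (jTangent j (fun i : (Finset.univ : Finset (Fin (dimG y SigmaSet))) =>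
        (y ∘ f) i)) := by
    refine dimj_le_finrank_jTangent fun D hD h0 => ?_
    rintro _ ⟨l, rfl⟩
    rcases hcov (Sum.inr l) with ⟨i, hi⟩ | ⟨c, hc, hi⟩
    · exact hD.eq_zero_of_GRel hi (h0 ⟨i, Finset.mem_univ i⟩)
    · exact hD.eq_zero_of_GRel (hi.symm (hy (.inr l))) (hD.eq_zero_of_mem_SigmaSet hc)
  rw [Finset.card_univ, Fintype.card_fin] at hTc
  constructor
  · rw [jTuple_comp] at hT
    obtain ⟨h1, h2⟩ := algebraicIndepOn_image_of_comp hT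
    have h3 : _ ≤ trdegF ⊥ (jTuple j y) := card_le_trdegF h1
    change _ ≤ trdegF ⊥ (jTuple j y)
    omega
  · let F : Fin 4 × Fin (dimG y SigmaSet) → (Fin n ⊕ Fin m) ⊕ (Fin n ⊕ Fin m) :=
      fun p => if p.1 = 0 then .inl (f p.2) else .inr (f p.2)
    let Q : Finset (Fin 4 × Fin (dimG y SigmaSet)) := {2, 3} ×ˢ Finset.univ
    have hQ : Q.card = 2 * dimG y SigmaSet := by simp [Q]
    have hsub : AlgebraicIndepOn (⊥ : Subfield ℂ) (Sum.elim y (j ∘ y) ∘ F)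
        ((T \ Q : Finset _) : Set (Fin 4 × Fin (dimG y SigmaSet))) := by
      refine (algebraicIndependent_equiv' (Equiv.refl _) ?_).1
        (AlgebraicIndepOn.mono hT (Finset.coe_subset.2 (Finset.sdiff_subset (t := Q))))
      ext ⟨⟨k, i⟩, hp⟩
      have hk : k ≠ 2 ∧ k ≠ 3 := by
        simpa [Q] using (Finset.mem_sdiff.1 hp).2
      have hk' : k = 0 ∨ k = 1 := by omega
      rcases hk' with rfl | rfl <;> simp [F, jTuple]
    obtain ⟨h1, h2⟩ := algebraicIndepOn_image_of_comp hsub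
    have h3 := card_le_trdegF h1
    have h4 := Finset.le_card_sdiff Q T
    omega

end ModularJPaper
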